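/- arXiv:1805.04640 — 4 statements merged into one kernel-verified Lean document; each statement's English description precedes it below -/
import Mathlib

section
/- Let p be a prime, μ an additive Haar measure on ℚ_p normalized so that μ(ℤ_p) = 1, and Φ : ℚ_p × ℚ_p → ℂ a locally constant compactly supported function. Then there exist locally constant compactly supported functions C_1, C_2 : ℚ_p → ℂ such that for every Borel set E ⊆ ℚ_p, ∫_{{(x,y) : x·y ∈ E}} Φ(x,y) d(μ×μ) = ∫_E (C_1(ξ) + C_2(ξ)·v(ξ)) dμ(ξ), where v(ξ) ∈ ℤ denotes the p-adic valuation of ξ (the value at ξ = 0 is irrelevant, {0} being μ-null). In other words, the push-forward of the measure Φ·(μ×μ) under the multiplication map (x,y) ↦ xy has density C_1(ξ) + C_2(ξ)·v(ξ) with respect to μ. -/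
open MeasureTheory

namespace PadicGerm

open Set Filter Topology

variable {p : ℕ} [Fact p.Prime]

/-- Invariance of a function on `ℚ_p` under translations of norm at most `δ`, together with
vanishing outside the ball of radius `R`. -/
structure InvSupp (f : ℚ_[p] → ℂ) (δ R : ℝ) : Prop where
  inv : ∀ x x', ‖x - x'‖ ≤ δ → f x = f x'
  supp : ∀ x, R < ‖x‖ → f x = 0

/-- The two-variable version of `InvSupp`. -/
structure InvSupp₂ (Φ : ℚ_[p] → ℚ_[p] → ℂ) (δ R : ℝ) : Prop where
  inv : ∀ x x' y y', ‖x - x'‖ ≤ δ → ‖y - y'‖ ≤ δ → Φ x y = Φ x' y'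
  supp_left : ∀ x y, R < ‖x‖ → Φ x y = 0
  supp_right : ∀ x y, R < ‖y‖ → Φ x y = 0

lemma norm_le_of_sub_le {x x' : ℚ_[p]} {δ : ℝ} (h : ‖x - x'‖ ≤ δ) (hx : ‖x'‖ ≤ δ) : ‖x‖ ≤ δ := by
  have := Padic.nonarchimedean (x - x') x'
  rw [sub_add_cancel] at this
  exact this.trans (max_le h hx)

lemma norm_le_iff_of_sub_le {x x' : ℚ_[p]} {δ : ℝ} (h : ‖x - x'‖ ≤ δ) : ‖x‖ ≤ δ ↔ ‖x'‖ ≤ δ :=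
  ⟨norm_le_of_sub_le (by rwa [norm_sub_rev]), norm_le_of_sub_le h⟩

lemma norm_eq_of_sub_lt {x x' : ℚ_[p]} (h : ‖x - x'‖ < ‖x'‖) : ‖x‖ = ‖x'‖ := by
  have := Padic.add_eq_max_of_ne h.ne
  rw [sub_add_cancel] at this
  rw [this, max_eq_right h.le]

lemma valuation_eq_of_norm_eq {x x' : ℚ_[p]} (hx : x' ≠ 0) (h : ‖x‖ = ‖x'‖) :
    x.valuation = x'.valuation := by
  have hx0 : x ≠ 0 := by rw [← norm_pos_iff, h]; exact norm_pos_iff.2 hx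
  have hp : (1 : ℝ) < p := mod_cast (Fact.out : p.Prime).one_lt
  rw [Padic.norm_eq_zpow_neg_valuation hx0, Padic.norm_eq_zpow_neg_valuation hx] at h
  have := zpow_right_injective₀ (by linarith) hp.ne' h
  omega

lemma norm_le_zpow_iff {x : ℚ_[p]} (hx : x ≠ 0) (n : ℤ) :
    ‖x‖ ≤ (p : ℝ) ^ (-n) ↔ n ≤ x.valuation := by
  have hp : (1 : ℝ) < p := mod_cast (Fact.out : p.Prime).one_lt
  rw [Padic.norm_eq_zpow_neg_valuation hx, zpow_le_zpow_iff_right₀ hp, neg_le_neg_iff]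

lemma InvSupp.isLocallyConstant {f : ℚ_[p] → ℂ} {δ R : ℝ} (h : InvSupp f δ R) (hδ : 0 < δ) :
    IsLocallyConstant f := by
  rw [IsLocallyConstant.iff_eventually_eq]
  intro x
  filter_upwards [Metric.ball_mem_nhds x hδ] with y hy
  exact h.inv _ _ (by rw [← dist_eq_norm]; exact (Metric.mem_ball.1 hy).le)

lemma hasCompactSupport_of_norm {f : ℚ_[p] → ℂ} {R : ℝ} (h : ∀ x, R < ‖x‖ → f x = 0) :
    HasCompactSupport f :=
  HasCompactSupport.intro (isCompact_closedBall 0 R) fun x hx => h x (by simpa using hx)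

lemma InvSupp₂.continuous {Φ : ℚ_[p] → ℚ_[p] → ℂ} {δ R : ℝ} (h : InvSupp₂ Φ δ R) (hδ : 0 < δ) :
    Continuous (Function.uncurry Φ) := by
  apply IsLocallyConstant.continuous
  rw [IsLocallyConstant.iff_eventually_eq]
  intro x
  filter_upwards [Metric.ball_mem_nhds x hδ] with y hy
  have := (Metric.mem_ball.1 hy).le
  rw [Prod.dist_eq, max_le_iff, dist_eq_norm, dist_eq_norm] at this
  exact h.inv _ _ _ _ this.1 this.2

lemma InvSupp₂.hasCompactSupport {Φ : ℚ_[p] → ℚ_[p] → ℂ} {δ R : ℝ} (h : InvSupp₂ Φ δ R) :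
    HasCompactSupport (Function.uncurry Φ) := by
  refine HasCompactSupport.intro
    ((isCompact_closedBall (0 : ℚ_[p]) R).prod (isCompact_closedBall 0 R)) fun x hx => ?_
  simp only [mem_prod, Metric.mem_closedBall, dist_zero_right, not_and_or, not_le] at hx
  exact hx.elim (h.supp_left _ _) (h.supp_right _ _)

lemma InvSupp₂.sub {Φ Ψ : ℚ_[p] → ℚ_[p] → ℂ} {δ R : ℝ} (h : InvSupp₂ Φ δ R)
    (h' : InvSupp₂ Ψ δ R) : InvSupp₂ (fun x y => Φ x y - Ψ x y) δ R where
  inv x x' y y' hx hy := by rw [h.inv x x' y y' hx hy, h'.inv x x' y y' hx hy]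
  supp_left x y hx := by rw [h.supp_left x y hx, h'.supp_left x y hx, sub_zero]
  supp_right x y hx := by rw [h.supp_right x y hx, h'.supp_right x y hx, sub_zero]

lemma InvSupp₂.flip {Φ : ℚ_[p] → ℚ_[p] → ℂ} {δ R : ℝ} (h : InvSupp₂ Φ δ R) :
    InvSupp₂ (fun x y => Φ y x) δ R where
  inv _ _ _ _ hx hy := h.inv _ _ _ _ hy hx
  supp_left _ _ hx := h.supp_right _ _ hx
  supp_right _ _ hx := h.supp_left _ _ hx

lemma InvSupp.tensor {f : ℚ_[p] → ℂ} {δ R : ℝ} (h : InvSupp f δ R) (hδR : δ ≤ R) :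
    InvSupp₂ (fun x y => if ‖y‖ ≤ δ then f x else 0) δ R where
  inv x x' y y' hx hy := by simp only [norm_le_iff_of_sub_le hy, h.inv x x' hx]
  supp_left x y hx := by simp [h.supp x hx]
  supp_right x y hx := if_neg (by linarith)

/-- A locally constant function with compact support on `ℚ_p × ℚ_p` is uniformly locally
constant. -/
lemma exists_invSupp₂ {Φ : ℚ_[p] × ℚ_[p] → ℂ} (hΦ : IsLocallyConstant Φ)
    (hΦc : HasCompactSupport Φ) :
    ∃ (n : ℤ) (R : ℝ), (p : ℝ) ^ (-n) ≤ R ∧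
      InvSupp₂ (fun x y => Φ (x, y)) ((p : ℝ) ^ (-n)) R := by
  obtain ⟨δ, hδ, hδ'⟩ := lebesgue_number_lemma_of_metric (s := tsupport Φ)
    (c := fun z : ℂ => Φ ⁻¹' {z}) hΦc (fun z => hΦ.isOpen_fiber z) (fun x _ => by simp)
  obtain ⟨R, hR⟩ := (Metric.isBounded_iff_subset_closedBall (0 : ℚ_[p] × ℚ_[p])).1 hΦc.isBounded
  have hp : (1 : ℝ) < p := mod_cast (Fact.out : p.Prime).one_lt
  obtain ⟨n, hn⟩ := exists_pow_lt_of_lt_one hδ (inv_lt_one_of_one_lt₀ hp)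
  have key : ∀ q ∈ tsupport Φ, ∀ q', dist q' q < δ → Φ q' = Φ q := by
    intro q hq q' hqq
    obtain ⟨z, hz⟩ := hδ' q hq
    have h1 : Φ q = z := hz (Metric.mem_ball_self hδ)
    have h2 : Φ q' = z := hz hqq
    rw [h1, h2]
  have hzero : ∀ q : ℚ_[p] × ℚ_[p], max R ((p : ℝ) ^ (-(n : ℤ))) < ‖q‖ → Φ q = 0 := by
    intro q hq
    by_contra h0
    have := hR (subset_tsupport _ h0)
    rw [mem_closedBall_zero_iff] at this
    exact absurd this (not_le.2 ((le_max_left _ _).trans_lt hq))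
  refine ⟨n, max R ((p : ℝ) ^ (-(n : ℤ))), le_max_right _ _, ⟨?_, ?_, ?_⟩⟩
  · intro x x' y y' hx hy
    have hd : dist (x, y) (x', y') < δ := by
      rw [Prod.dist_eq, dist_eq_norm, dist_eq_norm]
      refine (max_le hx hy).trans_lt ?_
      simpa using hn
    by_cases h1 : (x', y') ∈ tsupport Φ
    · exact key _ h1 _ hd
    by_cases h2 : (x, y) ∈ tsupport Φ
    · exact (key _ h2 _ (by rwa [dist_comm])).symm
    · simp only [image_eq_zero_of_notMem_tsupport h1, image_eq_zero_of_notMem_tsupport h2]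
  · exact fun x y hx => hzero _ (hx.trans_le (le_max_left _ _))
  · exact fun x y hx => hzero _ (hx.trans_le (le_max_right _ _))

open Classical in
/-- The density of `|x|⁻¹ dx`, when dilation by `x` scales Haar measure by `r ^ v(x)`. -/
noncomputable def weight (r : NNReal) (x : ℚ_[p]) : ℂ :=
  if x = 0 then 0 else (((r ^ x.valuation)⁻¹ : NNReal) : ℂ)

lemma weight_congr {r : NNReal} {x x' : ℚ_[p]} (h : ‖x‖ = ‖x'‖) : weight r x = weight r x' := by
  by_cases hx : x' = 0
  · have : x = 0 := by rw [← norm_eq_zero, h, hx, norm_zero]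
    rw [this, hx]
  · have hx0 : x ≠ 0 := by rw [← norm_ne_zero_iff, h]; exact norm_ne_zero_iff.2 hx
    rw [weight, weight, if_neg hx, if_neg hx0, valuation_eq_of_norm_eq hx h]

variable [MeasurableSpace ℚ_[p]] [BorelSpace ℚ_[p]]

lemma InvSupp.integrable {f : ℚ_[p] → ℂ} {δ R : ℝ} (h : InvSupp f δ R) (hδ : 0 < δ)
    (μ : Measure ℚ_[p]) [μ.IsAddHaarMeasure] : Integrable f μ :=
  (h.isLocallyConstant hδ).continuous.integrable_of_hasCompactSupport
    (hasCompactSupport_of_norm h.supp)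

lemma InvSupp₂.integrable {Φ : ℚ_[p] → ℚ_[p] → ℂ} {δ R : ℝ} (h : InvSupp₂ Φ δ R) (hδ : 0 < δ)
    (μ : Measure ℚ_[p]) [μ.IsAddHaarMeasure] : Integrable (Function.uncurry Φ) (μ.prod μ) :=
  (h.continuous hδ).integrable_of_hasCompactSupport h.hasCompactSupport

lemma measurable_valuation : Measurable (Padic.valuation : ℚ_[p] → ℤ) := by
  have hp : (0 : ℝ) < p := mod_cast (Fact.out : p.Prime).pos
  refine measurable_to_countable' fun k => ?_
  have h : MeasurableSet {x : ℚ_[p] | ‖x‖ = (p : ℝ) ^ (-k)} :=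
    measurableSet_eq_fun measurable_norm measurable_const
  have key : ∀ x : ℚ_[p], x ≠ 0 → (x.valuation = k ↔ ‖x‖ = (p : ℝ) ^ (-k)) := by
    intro x hx
    have hp : (1 : ℝ) < p := mod_cast (Fact.out : p.Prime).one_lt
    rw [Padic.norm_eq_zpow_neg_valuation hx, (zpow_right_injective₀ (by linarith) hp.ne').eq_iff,
      neg_inj]
  by_cases hk : k = 0
  · convert h.union (measurableSet_singleton (0 : ℚ_[p])) using 1
    ext x
    by_cases hx : x = 0
    · simp [hx, hk]
    · simp [hx, key x hx]
  · convert h using 1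
    ext x
    by_cases hx : x = 0
    · simpa [hx, Ne.symm hk] using (zpow_pos hp (-k)).ne
    · simp [key x hx]

lemma distribHaarChar_eq_one {u : ℚ_[p]ˣ} (hu : ‖(u : ℚ_[p])‖ = 1) :
    distribHaarChar ℚ_[p] u = 1 := by
  refine distribHaarChar_eq_of_measure_smul_eq_mul (μ := Measure.addHaar)
    (s := Metric.closedBall 0 1) ?_ ?_ ?_
  · exact (Metric.measure_closedBall_pos _ _ one_pos).ne'
  · exact (isCompact_closedBall _ _).measure_lt_top.ne
  · rw [ENNReal.coe_one, one_mul]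
    congr 1
    ext x
    rw [mem_smul_set_iff_inv_smul_mem]
    simp [Units.smul_def, hu]

/-- Dilation by `a ≠ 0` scales a Haar measure by a power of the valuation of `a`. -/
lemma exists_map_mul_left_eq (μ : Measure ℚ_[p]) [μ.IsAddHaarMeasure] :
    ∃ r : NNReal, ∀ a : ℚ_[p], a ≠ 0 →
      μ.map (a * ·) = (r ^ a.valuation)⁻¹ • μ := by
  have hp : (p : ℚ_[p]) ≠ 0 := mod_cast (Fact.out : p.Prime).ne_zero
  refine ⟨distribHaarChar ℚ_[p] (Units.mk0 (p : ℚ_[p]) hp), fun a ha => ?_⟩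
  have hchar : distribHaarChar ℚ_[p] (Units.mk0 a ha) =
      distribHaarChar ℚ_[p] (Units.mk0 (p : ℚ_[p]) hp) ^ a.valuation := by
    rw [← map_zpow, ← mul_inv_eq_one₀ distribHaarChar_pos.ne', ← map_inv, ← map_mul]
    apply distribHaarChar_eq_one
    have hp' : (p : ℝ) ≠ 0 := mod_cast (Fact.out : p.Prime).ne_zero
    simp only [Units.val_mul, Units.val_mk0, norm_mul, Padic.norm_eq_zpow_neg_valuation ha,
      Units.val_inv_eq_inv_val, Units.val_zpow_eq_zpow_val, norm_inv, norm_zpow, Padic.norm_p]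
    simp [inv_mul_cancel₀ (zpow_ne_zero a.valuation hp')]
  ext s hs
  rw [Measure.map_apply (by fun_prop) hs, ← hchar, ← map_inv, Measure.smul_apply,
    ENNReal.smul_def, smul_eq_mul, distribHaarChar_mul]
  congr 1
  ext x
  rw [mem_smul_set_iff_inv_smul_mem]
  simp [Units.smul_def]

/-- The orbital integral `ξ ↦ ∫ Φ(x, ξ/x) |x|⁻¹ dx`. -/
noncomputable def orbital (μ : Measure ℚ_[p]) (r : NNReal) (Φ : ℚ_[p] → ℚ_[p] → ℂ)
    (ξ : ℚ_[p]) : ℂ :=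
  ∫ x, weight r x * Φ x (ξ / x) ∂μ

lemma measurable_weight (r : NNReal) : Measurable (weight r : ℚ_[p] → ℂ) := by
  refine Measurable.ite (p := fun x : ℚ_[p] => x = 0) (measurableSet_singleton 0) measurable_const ?_
  have h : Measurable fun k : ℤ => (((r ^ k)⁻¹ : NNReal) : ℂ) := measurable_from_top
  exact h.comp measurable_valuation

section Orbital

variable {μ : Measure ℚ_[p]} [μ.IsAddHaarMeasure] {r : NNReal}

omit [μ.IsAddHaarMeasure] in
lemma integral_comp_mul_left (hr : ∀ a : ℚ_[p], a ≠ 0 → μ.map (a * ·) = (r ^ a.valuation)⁻¹ • μ)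
    {a : ℚ_[p]} (ha : a ≠ 0) (k : ℚ_[p] → ℂ) :
    ∫ y, k (a * y) ∂μ = weight r a * ∫ ξ, k ξ ∂μ := by
  have := (Homeomorph.mulLeft₀ a ha).measurableEmbedding.integral_map (μ := μ) k
  rw [Homeomorph.coe_mulLeft₀] at this
  rw [← this, hr a ha, integral_smul_nnreal_measure, weight, if_neg ha]
  rfl

omit [μ.IsAddHaarMeasure] in
lemma integrable_comp_div (hr : ∀ a : ℚ_[p], a ≠ 0 → μ.map (a * ·) = (r ^ a.valuation)⁻¹ • μ)
    {a : ℚ_[p]} (ha : a ≠ 0) {k : ℚ_[p] → ℂ} (hk : Integrable k μ) :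
    Integrable (fun ξ => k (ξ / a)) μ := by
  have h := hr a⁻¹ (inv_ne_zero ha)
  have h2 : Integrable k (μ.map (a⁻¹ * ·)) := by
    rw [h]
    exact hk.smul_measure_nnreal
  have := ((Homeomorph.mulLeft₀ a⁻¹ (inv_ne_zero ha)).measurableEmbedding.integrable_map_iff).1 h2
  refine this.congr (.of_forall fun ξ => ?_)
  simp [div_eq_inv_mul]

lemma integrable_weight_mul
    (hr : ∀ a : ℚ_[p], a ≠ 0 → μ.map (a * ·) = (r ^ a.valuation)⁻¹ • μ)
    {Φ : ℚ_[p] → ℚ_[p] → ℂ} {δ R : ℝ} (h : InvSupp₂ Φ δ R) (hδ : 0 < δ) :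
    Integrable (fun q : ℚ_[p] × ℚ_[p] => weight r q.1 * Φ q.1 (q.2 / q.1)) (μ.prod μ) := by
  have hint := h.integrable hδ μ
  have hmeas : Measurable (Function.uncurry Φ) := (h.continuous hδ).measurable
  have hm : Measurable fun q : ℚ_[p] × ℚ_[p] => weight r q.1 * Φ q.1 (q.2 / q.1) :=
    ((measurable_weight r).comp measurable_fst).mul
      (hmeas.comp (measurable_fst.prodMk (measurable_snd.div measurable_fst)))
  have hne : ∀ᵐ x ∂μ, x ≠ 0 := by simp [ae_iff]
  rw [integrable_prod_iff hm.aestronglyMeasurable]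
  constructor
  · filter_upwards [hint.prod_right_ae, hne] with x hx hx0
    exact (integrable_comp_div hr hx0 hx).const_mul _
  · refine hint.integral_norm_prod_left.congr ?_
    filter_upwards [hne] with x hx0
    have := integral_comp_mul_left hr hx0 (fun ξ => (‖Φ x (ξ / x)‖ : ℂ))
    simp only [mul_div_cancel_left₀ _ hx0] at this
    have hw : weight r x = (‖weight r x‖ : ℂ) := by simp [weight, hx0]
    rw [hw] at this
    simp only [norm_mul]
    rw [integral_const_mul]
    apply Complex.ofReal_injective
    rw [Complex.ofReal_mul, ← integral_complex_ofReal, ← integral_complex_ofReal, ← this]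
    rfl

lemma integrable_orbital
    (hr : ∀ a : ℚ_[p], a ≠ 0 → μ.map (a * ·) = (r ^ a.valuation)⁻¹ • μ)
    {Φ : ℚ_[p] → ℚ_[p] → ℂ} {δ R : ℝ} (h : InvSupp₂ Φ δ R) (hδ : 0 < δ) :
    Integrable (orbital μ r Φ) μ :=
  (integrable_weight_mul hr h hδ).integral_prod_right

/-- The orbital integral is the density of the push-forward under multiplication. -/
lemma setIntegral_mul_mem_eq
    (hr : ∀ a : ℚ_[p], a ≠ 0 → μ.map (a * ·) = (r ^ a.valuation)⁻¹ • μ)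
    {Φ : ℚ_[p] → ℚ_[p] → ℂ} {δ R : ℝ} (h : InvSupp₂ Φ δ R) (hδ : 0 < δ)
    {E : Set ℚ_[p]} (hE : MeasurableSet E) :
    ∫ q in {q : ℚ_[p] × ℚ_[p] | q.1 * q.2 ∈ E}, Φ q.1 q.2 ∂(μ.prod μ) =
      ∫ ξ in E, orbital μ r Φ ξ ∂μ := by
  have hS : MeasurableSet {q : ℚ_[p] × ℚ_[p] | q.1 * q.2 ∈ E} :=
    (measurable_fst.mul measurable_snd) hE
  have hne : ∀ᵐ x ∂μ, x ≠ 0 := by simp [ae_iff]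
  have hint := (h.integrable hδ μ).indicator hS
  have hint2 := (integrable_weight_mul hr h hδ).indicator (measurable_snd hE)
  rw [← integral_indicator hS, ← integral_indicator hE]
  calc _ = ∫ x, ∫ y, {q : ℚ_[p] × ℚ_[p] | q.1 * q.2 ∈ E}.indicator
          (Function.uncurry Φ) (x, y) ∂μ ∂μ := integral_prod _ hint
    _ = ∫ x, ∫ ξ, (Prod.snd ⁻¹' E).indicator
          (fun q : ℚ_[p] × ℚ_[p] => weight r q.1 * Φ q.1 (q.2 / q.1)) (x, ξ) ∂μ ∂μ := by
        refine integral_congr_ae ?_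
        filter_upwards [hne] with x hx0
        have := integral_comp_mul_left hr hx0 (fun ξ => E.indicator (fun ξ => Φ x (ξ / x)) ξ)
        rw [← integral_const_mul] at this
        refine Eq.trans (integral_congr_ae (.of_forall fun y => ?_))
          (this.trans (integral_congr_ae (.of_forall fun y => ?_)))
        · by_cases hy : x * y ∈ E <;> simp [indicator, hy, mul_div_cancel_left₀ _ hx0]
        · by_cases hy : y ∈ E <;> simp [indicator, hy]
    _ = ∫ ξ, ∫ x, (Prod.snd ⁻¹' E).indicator
          (fun q : ℚ_[p] × ℚ_[p] => weight r q.1 * Φ q.1 (q.2 / q.1)) (x, ξ) ∂μ ∂μ :=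
        integral_integral_swap hint2
    _ = _ := by
        congr 1 with ξ
        by_cases hξ : ξ ∈ E <;> simp [indicator, hξ, orbital]

omit [BorelSpace ℚ_[p]] [μ.IsAddHaarMeasure] in
lemma orbital_eq_zero {Φ : ℚ_[p] → ℚ_[p] → ℂ} {δ R : ℝ} (h : InvSupp₂ Φ δ R) (hR : 0 < R)
    {ξ : ℚ_[p]} (hξ : R * R < ‖ξ‖) : orbital μ r Φ ξ = 0 := by
  refine integral_eq_zero_of_ae (.of_forall fun x => ?_)
  by_cases hx0 : x = 0
  · simp [weight, hx0]
  have hx : 0 < ‖x‖ := norm_pos_iff.2 hx0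
  simp only [Pi.zero_apply, mul_eq_zero]
  right
  by_cases hxR : R < ‖x‖
  · exact h.supp_left _ _ hxR
  · apply h.supp_right
    rw [norm_div, lt_div_iff₀ hx]
    nlinarith

omit [BorelSpace ℚ_[p]] [μ.IsAddHaarMeasure] in
lemma eventually_orbital_eq {Φ : ℚ_[p] → ℚ_[p] → ℂ} {δ R : ℝ} (h : InvSupp₂ Φ δ R)
    (hδ : 0 < δ) (hR : 0 < R) {ξ : ℚ_[p]} (hξ : ξ ≠ 0) :
    ∀ᶠ ξ' in 𝓝 ξ, orbital μ r Φ ξ' = orbital μ r Φ ξ := by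
  have hξ' : 0 < ‖ξ‖ := norm_pos_iff.2 hξ
  have hε : 0 < min ‖ξ‖ (δ * (‖ξ‖ / R)) := by positivity
  filter_upwards [Metric.ball_mem_nhds ξ hε] with ξ' hd
  rw [Metric.mem_ball, dist_eq_norm, lt_min_iff] at hd
  have hn := norm_eq_of_sub_lt hd.1
  refine integral_congr_ae (.of_forall fun x => ?_)
  by_cases hx0 : x = 0
  · simp [weight, hx0]
  have hx : 0 < ‖x‖ := norm_pos_iff.2 hx0
  simp only
  congr 1
  by_cases hxR : ‖x‖ < ‖ξ‖ / R
  · have : R < ‖ξ‖ / ‖x‖ := by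
      rw [lt_div_iff₀ hx]
      rwa [lt_div_iff₀ hR, mul_comm] at hxR
    rw [h.supp_right x (ξ / x) (by rwa [norm_div]), h.supp_right x (ξ' / x) (by rwa [norm_div, hn])]
  · refine h.inv _ _ _ _ (by simpa using hδ.le) ?_
    rw [← sub_div, norm_div, div_le_iff₀ hx]
    exact hd.2.le.trans (mul_le_mul_of_nonneg_left (not_lt.1 hxR) hδ.le)

end Orbital

/-- `Φ` satisfies the germ expansion: the push-forward of `Φ · (μ × μ)` under multiplication has
an integrable density `C₁ + C₂ · v` with `C₁`, `C₂` Schwartz-Bruhat. -/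
def HasGermExpansion (μ : Measure ℚ_[p]) (Φ : ℚ_[p] → ℚ_[p] → ℂ) : Prop :=
  ∃ C₁ C₂ : ℚ_[p] → ℂ,
    IsLocallyConstant C₁ ∧ HasCompactSupport C₁ ∧
    IsLocallyConstant C₂ ∧ HasCompactSupport C₂ ∧
    Integrable (fun ξ => C₁ ξ + C₂ ξ * (ξ.valuation : ℂ)) μ ∧
    ∀ E : Set ℚ_[p], MeasurableSet E →
      (∫ q in {q : ℚ_[p] × ℚ_[p] | q.1 * q.2 ∈ E}, Φ q.1 q.2 ∂(μ.prod μ)) =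
        ∫ ξ in E, (C₁ ξ + C₂ ξ * (ξ.valuation : ℂ)) ∂μ

variable {μ : Measure ℚ_[p]} [μ.IsAddHaarMeasure] {r : NNReal}

/-- An asymptotic formula for the orbital integral near `0` gives the germ expansion. -/
lemma hasGermExpansion_of_orbital
    (hr : ∀ a : ℚ_[p], a ≠ 0 → μ.map (a * ·) = (r ^ a.valuation)⁻¹ • μ)
    {Φ : ℚ_[p] → ℚ_[p] → ℂ} {δ R : ℝ} (h : InvSupp₂ Φ δ R) (hδ : 0 < δ) (hR : 0 < R)
    {ε : ℝ} (hε : 0 < ε) (K c : ℂ)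
    (hK : ∀ ξ : ℚ_[p], ξ ≠ 0 → ‖ξ‖ ≤ ε → orbital μ r Φ ξ = K + c * (ξ.valuation : ℂ)) :
    HasGermExpansion μ Φ := by
  have hloc : ∀ ξ : ℚ_[p], ∀ᶠ ξ' in 𝓝 ξ, (‖ξ'‖ ≤ ε ↔ ‖ξ‖ ≤ ε) := fun ξ => by
    filter_upwards [Metric.ball_mem_nhds ξ hε] with ξ' hd
    rw [Metric.mem_ball, dist_eq_norm] at hd
    exact norm_le_iff_of_sub_le hd.le
  have hne : ∀ᵐ x ∂μ, x ≠ 0 := by simp [ae_iff]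
  set C₁ : ℚ_[p] → ℂ := fun ξ => if ‖ξ‖ ≤ ε then K else orbital μ r Φ ξ with hC₁
  set C₂ : ℚ_[p] → ℂ := fun ξ => if ‖ξ‖ ≤ ε then c else 0 with hC₂
  have hae : orbital μ r Φ =ᵐ[μ] fun ξ => C₁ ξ + C₂ ξ * (ξ.valuation : ℂ) := by
    filter_upwards [hne] with ξ hξ
    by_cases h1 : ‖ξ‖ ≤ ε
    · simp [hC₁, hC₂, h1, hK ξ hξ h1]
    · simp [hC₁, hC₂, h1]
  refine ⟨C₁, C₂, ?_, ?_, ?_, ?_, (integrable_orbital (μ := μ) hr h hδ).congr hae, fun E hE => ?_⟩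
  · rw [IsLocallyConstant.iff_eventually_eq]
    intro ξ
    by_cases h1 : ‖ξ‖ ≤ ε
    · filter_upwards [hloc ξ] with ξ' h2
      simp [hC₁, h1, h2]
    · have hξ : ξ ≠ 0 := by rintro rfl; simp [hε.le] at h1
      filter_upwards [hloc ξ, eventually_orbital_eq (μ := μ) (r := r) h hδ hR hξ] with ξ' h2 h3
      simp [hC₁, h1, h2, h3]
  · refine hasCompactSupport_of_norm (R := max ε (R * R)) fun x hx => ?_
    rw [max_lt_iff] at hx
    simp only [hC₁, if_neg (not_le.2 hx.1), orbital_eq_zero h hR hx.2]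
  · rw [IsLocallyConstant.iff_eventually_eq]
    intro ξ
    filter_upwards [hloc ξ] with ξ' h2
    simp [hC₂, h2]
  · exact hasCompactSupport_of_norm (R := ε) fun x hx => if_neg (not_le.2 hx)
  · rw [setIntegral_mul_mem_eq hr h hδ hE]
    exact integral_congr_ae (ae_restrict_of_ae hae)

lemma measurableSet_valuation (s : Set ℤ) :
    MeasurableSet {x : ℚ_[p] | x ≠ 0 ∧ x.valuation ∈ s} :=
  (measurableSet_singleton (0 : ℚ_[p])).compl.inter (measurable_valuation (.of_discrete (s := s)))

omit [BorelSpace ℚ_[p]] in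
lemma measure_valuation_lt_top (n : ℤ) {s : Set ℤ} (hs : ∀ k ∈ s, n ≤ k) :
    μ {x : ℚ_[p] | x ≠ 0 ∧ x.valuation ∈ s} < ⊤ := by
  refine (measure_mono fun x hx => ?_).trans_lt
    (isCompact_closedBall (0 : ℚ_[p]) ((p : ℝ) ^ (-n))).measure_lt_top
  rw [mem_closedBall_zero_iff, norm_le_zpow_iff hx.1]
  exact hs _ hx.2

lemma integrableOn_weight_shell (m : ℤ) :
    IntegrableOn (weight r) {x : ℚ_[p] | x ≠ 0 ∧ x.valuation ∈ ({m} : Set ℤ)} μ := by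
  have h : IntegrableOn (fun _ => (((r ^ m)⁻¹ : NNReal) : ℂ))
      {x : ℚ_[p] | x ≠ 0 ∧ x.valuation ∈ ({m} : Set ℤ)} μ :=
    integrableOn_const (measure_valuation_lt_top m fun k hk => (mem_singleton_iff.1 hk).ge).ne
  refine h.congr_fun (fun x hx => ?_) (measurableSet_valuation _)
  simp only [weight, if_neg hx.1, mem_singleton_iff.1 hx.2]

omit [μ.IsAddHaarMeasure] in
/-- All shells have the same volume for the multiplicative measure. -/
lemma setIntegral_weight_shell
    (hr : ∀ a : ℚ_[p], a ≠ 0 → μ.map (a * ·) = (r ^ a.valuation)⁻¹ • μ) (m : ℤ) :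
    ∫ x in {x : ℚ_[p] | x ≠ 0 ∧ x.valuation ∈ ({m} : Set ℤ)}, weight r x ∂μ =
      ∫ _ in {x : ℚ_[p] | x ≠ 0 ∧ x.valuation ∈ ({0} : Set ℤ)}, (1 : ℂ) ∂μ := by
  have hp : (p : ℚ_[p]) ≠ 0 := mod_cast (Fact.out : p.Prime).ne_zero
  have ha : (p : ℚ_[p]) ^ m ≠ 0 := zpow_ne_zero _ hp
  have hv : ((p : ℚ_[p]) ^ m).valuation = m := by simp
  have h := integral_comp_mul_left hr ha
    ({x : ℚ_[p] | x ≠ 0 ∧ x.valuation ∈ ({m} : Set ℤ)}.indicator fun _ => 1)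
  rw [← integral_indicator (measurableSet_valuation _),
    ← integral_indicator (measurableSet_valuation _)]
  rw [← integral_const_mul] at h
  refine Eq.trans (integral_congr_ae (.of_forall fun x => ?_))
    (h.symm.trans (integral_congr_ae (.of_forall fun x => ?_)))
  · by_cases hx : x ≠ 0 ∧ x.valuation = m
    · have hx' : x ∈ {x : ℚ_[p] | x ≠ 0 ∧ x.valuation ∈ ({m} : Set ℤ)} := hx
      simp only [indicator_of_mem hx', weight, if_neg ha, hv, if_neg hx.1, hx.2, mul_one]
    · simp [indicator, hx]
  · by_cases hx : x = 0
    · simp [indicator, hx]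
    · simp only [indicator, mem_ofPred_eq, mem_singleton_iff, ne_eq, mul_eq_zero, ha, hx, or_self,
        Padic.valuation_mul ha hx, hv, add_eq_left]

omit [MeasurableSpace ℚ_[p]] [BorelSpace ℚ_[p]] in
lemma valuation_Icc_succ (n : ℤ) (k : ℕ) :
    {x : ℚ_[p] | x ≠ 0 ∧ x.valuation ∈ Icc n (n + (k + 1 : ℕ))} =
      {x : ℚ_[p] | x ≠ 0 ∧ x.valuation ∈ Icc n (n + k)} ∪
        {x : ℚ_[p] | x ≠ 0 ∧ x.valuation ∈ ({n + (k + 1 : ℕ)} : Set ℤ)} := by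
  ext x
  simp only [mem_ofPred_eq, mem_union, mem_Icc, mem_singleton_iff]
  push_cast
  by_cases hx : x = 0
  · simp [hx]
  · simp only [ne_eq, hx, not_false_eq_true, true_and]
    omega

lemma integral_weight_annulus
    (hr : ∀ a : ℚ_[p], a ≠ 0 → μ.map (a * ·) = (r ^ a.valuation)⁻¹ • μ) (n : ℤ) (k : ℕ) :
    IntegrableOn (weight r) {x : ℚ_[p] | x ≠ 0 ∧ x.valuation ∈ Icc n (n + k)} μ ∧
    ∫ x in {x : ℚ_[p] | x ≠ 0 ∧ x.valuation ∈ Icc n (n + k)}, weight r x ∂μ =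
      (k + 1) * ∫ _ in {x : ℚ_[p] | x ≠ 0 ∧ x.valuation ∈ ({0} : Set ℤ)}, (1 : ℂ) ∂μ := by
  induction k with
  | zero =>
    simp only [Nat.cast_zero, add_zero, Icc_self, zero_add, one_mul]
    exact ⟨integrableOn_weight_shell n, setIntegral_weight_shell hr n⟩
  | succ k ih =>
    rw [valuation_Icc_succ]
    refine ⟨ih.1.union (integrableOn_weight_shell _), ?_⟩
    rw [setIntegral_union _ (measurableSet_valuation _) ih.1 (integrableOn_weight_shell _), ih.2,
      setIntegral_weight_shell hr]
    · push_cast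
      ring
    · rw [disjoint_left]
      rintro x ⟨-, -, h1⟩ ⟨-, h2⟩
      rw [mem_singleton_iff] at h2
      push_cast at h2
      omega

/-- The germ expansion for a function of the first variable times the indicator of a small
ball in the second. -/
lemma hasGermExpansion_tensor
    (hr : ∀ a : ℚ_[p], a ≠ 0 → μ.map (a * ·) = (r ^ a.valuation)⁻¹ • μ)
    {f : ℚ_[p] → ℂ} {n : ℤ} {R : ℝ} (h : InvSupp f ((p : ℝ) ^ (-n)) R)
    (hR : (p : ℝ) ^ (-n) ≤ R) :
    HasGermExpansion μ (fun x y => if ‖y‖ ≤ (p : ℝ) ^ (-n) then f x else 0) := by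
  have hp : (0 : ℝ) < p := mod_cast (Fact.out : p.Prime).pos
  have hδ : (0 : ℝ) < (p : ℝ) ^ (-n) := zpow_pos hp _
  set V : ℂ := ∫ _ in {x : ℚ_[p] | x ≠ 0 ∧ x.valuation ∈ ({0} : Set ℤ)}, (1 : ℂ) ∂μ with hV
  set g : ℚ_[p] → ℂ := fun x => if ‖x‖ ≤ (p : ℝ) ^ (-n) then 0 else weight r x * f x with hg
  have hginv : InvSupp g ((p : ℝ) ^ (-n)) R := by
    refine ⟨fun x x' hx => ?_, fun x hx => ?_⟩
    · by_cases h1 : ‖x'‖ ≤ (p : ℝ) ^ (-n)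
      · simp only [hg, h1, norm_le_iff_of_sub_le hx, if_true]
      · simp only [hg, norm_le_iff_of_sub_le hx, h1, if_false]
        rw [h.inv _ _ hx, weight_congr (norm_eq_of_sub_lt (hx.trans_lt (not_le.1 h1)))]
    · simp [hg, h.supp x hx]
  refine hasGermExpansion_of_orbital hr (h.tensor hR) hδ (hδ.trans_le hR)
    (ε := (p : ℝ) ^ (-(2 * n))) (zpow_pos hp _)
    ((∫ x, g x ∂μ) + f 0 * V * (1 - 2 * n)) (f 0 * V) fun ξ hξ hξn => ?_
  rw [norm_le_zpow_iff hξ] at hξn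
  obtain ⟨k, hk⟩ := Int.eq_ofNat_of_zero_le (sub_nonneg.2 hξn)
  obtain ⟨hi, hT⟩ := integral_weight_annulus hr n k
  have hS := measurableSet_valuation (p := p) (Icc n (n + k))
  have hpt : ∀ x, weight r x * (if ‖ξ / x‖ ≤ (p : ℝ) ^ (-n) then f x else 0) =
      g x + {x : ℚ_[p] | x ≠ 0 ∧ x.valuation ∈ Icc n (n + k)}.indicator (weight r) x * f 0 := by
    intro x
    by_cases hx : x = 0
    · simp [hx, hg, weight, indicator]
    have hdiv : ‖ξ / x‖ ≤ (p : ℝ) ^ (-n) ↔ n ≤ ξ.valuation - x.valuation := by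
      rw [norm_le_zpow_iff (div_ne_zero hξ hx), div_eq_mul_inv,
        Padic.valuation_mul hξ (inv_ne_zero hx), Padic.valuation_inv, sub_eq_add_neg]
    simp only [hg, hdiv, norm_le_zpow_iff hx, indicator, mem_ofPred_eq, ne_eq, hx,
      not_false_eq_true, true_and, mem_Icc]
    by_cases h1 : n ≤ x.valuation
    · have hf : f x = f 0 := h.inv _ _ (by rwa [sub_zero, norm_le_zpow_iff hx])
      by_cases h2 : x.valuation ≤ n + k
      · rw [if_pos (by omega), if_pos h1, if_pos ⟨h1, h2⟩, hf, zero_add]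
      · rw [if_neg (by omega), if_pos h1, if_neg (by tauto)]
        simp
    · rw [if_pos (by omega), if_neg h1, if_neg (by tauto)]
      simp
  rw [orbital]
  simp only [hpt]
  rw [integral_add (hginv.integrable hδ μ) ((hi.integrable_indicator hS).mul_const _),
    integral_mul_const, integral_indicator hS, hT]
  have hk' : (ξ.valuation : ℂ) - 2 * n = k := by exact_mod_cast hk
  rw [← hk']
  ring

/-- The germ expansion for functions vanishing near both coordinate axes. -/
lemma hasGermExpansion_of_eq_zero
    (hr : ∀ a : ℚ_[p], a ≠ 0 → μ.map (a * ·) = (r ^ a.valuation)⁻¹ • μ)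
    {Φ : ℚ_[p] → ℚ_[p] → ℂ} {δ R : ℝ} (h : InvSupp₂ Φ δ R) (hδ : 0 < δ) (hR : 0 < R)
    (hx : ∀ x y, ‖x‖ ≤ δ → Φ x y = 0) (hy : ∀ x y, ‖y‖ ≤ δ → Φ x y = 0) :
    HasGermExpansion μ Φ := by
  refine hasGermExpansion_of_orbital hr h hδ hR (mul_pos hδ hδ) 0 0 fun ξ _ hξ => ?_
  rw [zero_mul, add_zero]
  refine integral_eq_zero_of_ae (.of_forall fun x => ?_)
  by_cases hxδ : ‖x‖ ≤ δ
  · simp [hx _ _ hxδ]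
  · have : Φ x (ξ / x) = 0 := by
      apply hy
      rw [not_le] at hxδ
      rw [norm_div, div_le_iff₀ (hδ.trans hxδ)]
      exact hξ.trans (mul_le_mul_of_nonneg_left hxδ.le hδ.le)
    simp [this]

lemma HasGermExpansion.flip {Φ : ℚ_[p] → ℚ_[p] → ℂ} (h : HasGermExpansion μ Φ) :
    HasGermExpansion μ (fun x y => Φ y x) := by
  obtain ⟨C₁, C₂, h1, h2, h3, h4, h5, h6⟩ := h
  refine ⟨C₁, C₂, h1, h2, h3, h4, h5, fun E hE => ?_⟩
  have hS : MeasurableSet {q : ℚ_[p] × ℚ_[p] | q.1 * q.2 ∈ E} :=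
    (measurable_fst.mul measurable_snd) hE
  rw [← h6 E hE, ← integral_indicator hS, ← integral_indicator hS, ← integral_prod_swap]
  congr 1 with q
  have hq : q.2 * q.1 ∈ E ↔ q.1 * q.2 ∈ E := by rw [mul_comm]
  classical
  simp only [indicator_apply, mem_ofPred_eq, Prod.fst_swap, Prod.snd_swap]
  exact if_congr hq rfl rfl

omit [BorelSpace ℚ_[p]] [μ.IsAddHaarMeasure] in
lemma HasGermExpansion.add {Φ Ψ : ℚ_[p] → ℚ_[p] → ℂ} (h : HasGermExpansion μ Φ)
    (h' : HasGermExpansion μ Ψ) (hΦ : Integrable (Function.uncurry Φ) (μ.prod μ))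
    (hΨ : Integrable (Function.uncurry Ψ) (μ.prod μ)) :
    HasGermExpansion μ (fun x y => Φ x y + Ψ x y) := by
  obtain ⟨C₁, C₂, h1, h2, h3, h4, h5, h6⟩ := h
  obtain ⟨D₁, D₂, h1', h2', h3', h4', h5', h6'⟩ := h'
  have heq : ∀ ξ : ℚ_[p], (C₁ + D₁) ξ + (C₂ + D₂) ξ * (ξ.valuation : ℂ) =
      (C₁ ξ + C₂ ξ * (ξ.valuation : ℂ)) + (D₁ ξ + D₂ ξ * (ξ.valuation : ℂ)) := fun ξ => by
    simp only [Pi.add_apply]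
    ring
  refine ⟨C₁ + D₁, C₂ + D₂, h1.add h1', h2.add h2', h3.add h3', h4.add h4', ?_, fun E hE => ?_⟩
  · simp only [heq]
    exact h5.add h5'
  · simp only [heq]
    rw [integral_add h5.integrableOn h5'.integrableOn, ← h6 E hE, ← h6' E hE]
    exact integral_add hΦ.integrableOn hΨ.integrableOn

/-- The germ expansion for an arbitrary Schwartz-Bruhat function. -/
lemma InvSupp₂.hasGermExpansion {Φ : ℚ_[p] → ℚ_[p] → ℂ} {n : ℤ} {R : ℝ}
    (h : InvSupp₂ Φ ((p : ℝ) ^ (-n)) R) (hR : (p : ℝ) ^ (-n) ≤ R) : HasGermExpansion μ Φ := by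
  obtain ⟨r, hr⟩ := exists_map_mul_left_eq μ
  have hp : (0 : ℝ) < p := mod_cast (Fact.out : p.Prime).pos
  have hδ : (0 : ℝ) < (p : ℝ) ^ (-n) := zpow_pos hp _
  set δ := (p : ℝ) ^ (-n) with hδ_def
  set f : ℚ_[p] → ℂ := fun x => Φ x 0 with hf
  set g : ℚ_[p] → ℂ := fun y => Φ 0 y - if ‖y‖ ≤ δ then Φ 0 0 else 0 with hg
  have hfi : InvSupp f δ R :=
    ⟨fun x x' hx => h.inv _ _ _ _ hx (by simpa using hδ.le), fun x hx => h.supp_left _ _ hx⟩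
  have hgi : InvSupp g δ R := by
    refine ⟨fun y y' hy => ?_, fun y hy => ?_⟩
    · simp only [hg, norm_le_iff_of_sub_le hy, h.inv 0 0 y y' (by simpa using hδ.le) hy]
    · simp [hg, h.supp_right 0 y hy, not_le.2 (hR.trans_lt hy)]
  have hA := hfi.tensor hR
  have hB := (hgi.tensor hR).flip
  have hA' : HasGermExpansion μ _ := hasGermExpansion_tensor hr hfi hR
  have hB' : HasGermExpansion μ _ := (hasGermExpansion_tensor hr hgi hR).flip
  have hC := (h.sub hA).sub hB
  have hC' : HasGermExpansion μ fun x y => (Φ x y - if ‖y‖ ≤ δ then f x else 0) -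
      if ‖x‖ ≤ δ then g y else 0 := by
    refine hasGermExpansion_of_eq_zero hr hC hδ (hδ.trans_le hR) ?_ ?_
    · intro x y hx
      have h1 : Φ x y = Φ 0 y := h.inv _ _ _ _ (by simpa using hx) (by simpa using hδ.le)
      have h2 : Φ x 0 = Φ 0 0 := h.inv _ _ _ _ (by simpa using hx) (by simpa using hδ.le)
      simp only [hf, hg, h1, h2, if_pos hx]
      ring
    · intro x y hy
      have h1 : Φ x y = Φ x 0 := h.inv _ _ _ _ (by simpa using hδ.le) (by simpa using hy)
      have h2 : Φ 0 y = Φ 0 0 := h.inv _ _ _ _ (by simpa using hδ.le) (by simpa using hy)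
      simp [hf, hg, h1, h2, if_pos hy]
  have := ((hC'.add hB' (hC.integrable hδ μ) (hB.integrable hδ μ))).add hA'
    ((hC.integrable hδ μ).add (hB.integrable hδ μ)) (hA.integrable hδ μ)
  simpa only [← hδ_def, sub_add_cancel] using this

end PadicGerm

/-- Non-Archimedean split germ expansion: the push-forward under `(x,y) ↦ xy` of a Schwartz–Bruhat
measure on `ℚ_p²` has density `C₁(ξ) + C₂(ξ)·v(ξ)` with respect to Haar measure, with `C₁, C₂`
Schwartz–Bruhat and `v` the `p`-adic valuation. -/
theorem stmt_11 (p : ℕ) [Fact p.Prime]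
    [MeasurableSpace ℚ_[p]] [BorelSpace ℚ_[p]]
    (μ : Measure ℚ_[p]) [μ.IsAddHaarMeasure]
    (hμ : μ {x : ℚ_[p] | ‖x‖ ≤ 1} = 1)
    (Φ : ℚ_[p] × ℚ_[p] → ℂ) (hΦ : IsLocallyConstant Φ) (hΦc : HasCompactSupport Φ) :
    ∃ C₁ C₂ : ℚ_[p] → ℂ,
      IsLocallyConstant C₁ ∧ HasCompactSupport C₁ ∧
      IsLocallyConstant C₂ ∧ HasCompactSupport C₂ ∧
      ∀ E : Set ℚ_[p], MeasurableSet E →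
        (∫ q in {q : ℚ_[p] × ℚ_[p] | q.1 * q.2 ∈ E}, Φ q ∂(μ.prod μ)) =
          ∫ ξ in E, (C₁ ξ + C₂ ξ * (ξ.valuation : ℂ)) ∂μ := by

  obtain ⟨n, R, hR, h⟩ := PadicGerm.exists_invSupp₂ hΦ hΦc
  obtain ⟨C₁, C₂, h1, h2, h3, h4, -, h5⟩ := h.hasGermExpansion (μ := μ) hR
  exact ⟨C₁, C₂, h1, h2, h3, h4, h5⟩
end

section
/- Let p be an odd prime, μ an additive Haar measure on ℚ_p normalized so that μ(ℤ_p) = 1, and ε ∈ ℤ_p a unit (‖ε‖ = 1) which is not a square in ℚ_p; set Q(x,y) = x² − ε·y². Let Φ : ℚ_p × ℚ_p → ℂ be a locally constant compactly supported function. Then there exist locally constant compactly supported functions C_1, C_2 : ℚ_p → ℂ such that for every Borel set E ⊆ ℚ_p, ∫_{{(x,y) : Q(x,y) ∈ E}} Φ(x,y) d(μ×μ) = ∫_E (C_1(ξ) + C_2(ξ)·(−1)^{v(ξ)}) dμ(ξ), where v(ξ) ∈ ℤ denotes the p-adic valuation of ξ (the value at ξ = 0 is irrelevant, {0} being μ-null).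 -/
open MeasureTheory
theorem exists_sq_eq_of_norm_sub_one_lt {p : ℕ} [Fact p.Prime] (hp : p ≠ 2) {h : ℚ_[p]}
    (hh : ‖h - 1‖ < 1) : ∃ w : ℚ_[p], w ^ 2 = h ∧ ‖w - 1‖ = ‖h - 1‖ := by
  have h1 : ‖h‖ ≤ 1 := by
    have := IsUltrametricDist.norm_add_le_max (h - 1) 1
    rw [sub_add_cancel, norm_one] at this
    exact this.trans (max_le hh.le le_rfl)
  have h2 : ‖(2 : ℚ_[p])‖ = 1 := by
    have := (Padic.norm_natCast_eq_one_iff (p := p) (n := 2)).2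
      ((Nat.coprime_primes Fact.out Nat.prime_two).2 hp)
    exact_mod_cast this
  obtain ⟨h', hh'⟩ : ∃ z : ℤ_[p], (z : ℚ_[p]) = h := ⟨⟨h, h1⟩, rfl⟩
  let F : Polynomial ℤ_[p] := Polynomial.X ^ 2 - Polynomial.C h'
  have hd : Polynomial.aeval (1 : ℤ_[p]) F.derivative = 2 := by
    simp [F]; norm_num
  have h2' : ‖(2 : ℤ_[p])‖ = 1 := by rw [PadicInt.norm_def]; exact_mod_cast h2
  obtain ⟨z, hz, hz1, -⟩ := hensels_lemma (F := F) (a := 1) (by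
    rw [hd, h2']
    simp only [F, map_sub, map_pow, Polynomial.aeval_X, Polynomial.aeval_C]
    rw [PadicInt.norm_def]
    simpa [norm_sub_rev, hh'] using hh)
  rw [hd, h2', PadicInt.norm_def] at hz1
  push_cast at hz1
  have hz2 : (z : ℚ_[p]) ^ 2 = h := by
    have : z ^ 2 - h' = 0 := by simpa [F] using hz
    rw [← hh', ← sub_eq_zero.1 this, PadicInt.coe_pow]
  refine ⟨z, hz2, ?_⟩
  have h3 : ‖(z : ℚ_[p]) + 1‖ = 1 := by
    rw [show (z : ℚ_[p]) + 1 = (z - 1) + 2 by ring,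
      IsUltrametricDist.norm_add_eq_max_of_norm_ne_norm (by rw [h2]; exact hz1.ne), h2,
      max_eq_right hz1.le]
  rw [← hz2, show (z : ℚ_[p]) ^ 2 - 1 = (z - 1) * (z + 1) by ring, norm_mul, h3, mul_one]

theorem norm_sq_sub_mul_sq {p : ℕ} [Fact p.Prime] (hp : p ≠ 2) {ε : ℚ_[p]}
    (hε : ‖ε‖ = 1) (hεsq : ¬∃ y : ℚ_[p], y ^ 2 = ε) (q : ℚ_[p] × ℚ_[p]) :
    ‖q.1 ^ 2 - ε * q.2 ^ 2‖ = ‖q‖ ^ 2 := by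
  obtain ⟨x, y⟩ := q
  simp only [Prod.norm_mk]
  by_cases hxy : ‖x‖ = ‖y‖
  · rw [hxy, max_self]
    by_cases hy : y = 0
    · have hx : x = 0 := by simpa [hy] using hxy
      simp [hx, hy]
    have hx : x ≠ 0 := by rw [← norm_ne_zero_iff, hxy]; simpa using hy
    refine le_antisymm ?_ ?_
    · rw [sub_eq_add_neg]
      refine (IsUltrametricDist.norm_add_le_max _ _).trans ?_
      simp [hxy, hε]
    · by_contra! hlt
      obtain ⟨w, hw, -⟩ := exists_sq_eq_of_norm_sub_one_lt hp (h := ε * y ^ 2 / x ^ 2) (by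
        rw [show ε * y ^ 2 / x ^ 2 - 1 = -(x ^ 2 - ε * y ^ 2) / x ^ 2 by field_simp; ring,
          norm_div, norm_neg, norm_pow, hxy, div_lt_one (by positivity)]
        exact hlt)
      exact hεsq ⟨w * x / y, by field_simp; rw [hw]; field_simp⟩
  · have h1 : ‖x ^ 2‖ ≠ ‖-(ε * y ^ 2)‖ := by
      rw [norm_neg, norm_mul, hε, one_mul, norm_pow, norm_pow]
      exact fun h => hxy ((sq_eq_sq₀ (norm_nonneg _) (norm_nonneg _)).1 h)
    rw [sub_eq_add_neg, IsUltrametricDist.norm_add_eq_max_of_norm_ne_norm h1, norm_neg, norm_mul,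
      hε, one_mul, norm_pow, norm_pow]
    rcases le_total ‖x‖ ‖y‖ with h | h
    · rw [max_eq_right h, max_eq_right (by gcongr)]
    · rw [max_eq_left h, max_eq_left (by gcongr)]

theorem exists_sq_sub_mul_sq_eq_of_norm_eq_one {p : ℕ} [Fact p.Prime] (hp : p ≠ 2) {ε : ℚ_[p]}
    (hε : ‖ε‖ = 1) {a : ℚ_[p]} (ha : ‖a‖ = 1) :
    ∃ q : ℚ_[p] × ℚ_[p], q.1 ^ 2 - ε * q.2 ^ 2 = a := by
  let a' : ℤ_[p] := ⟨a, ha.le⟩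
  let ε' : ℤ_[p] := ⟨ε, hε.le⟩
  have hε0 : PadicInt.toZMod ε' ≠ 0 := by
    intro h
    rw [← RingHom.mem_ker, PadicInt.ker_toZMod, IsLocalRing.mem_maximalIdeal,
      PadicInt.mem_nonunits, PadicInt.norm_def] at h
    exact h.ne hε
  obtain ⟨x, y, hxy⟩ := FiniteField.exists_root_sum_quadratic
    (f := Polynomial.X ^ 2 - Polynomial.C (PadicInt.toZMod a'))
    (g := Polynomial.C (-PadicInt.toZMod ε') * Polynomial.X ^ 2)
    (Polynomial.degree_X_pow_sub_C (by decide) _)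
    (Polynomial.degree_C_mul_X_pow 2 (neg_ne_zero.2 hε0))
    (by rw [ZMod.card]; exact (Fact.out : p.Prime).eq_two_or_odd.resolve_left hp)
  set X : ℤ_[p] := (x.val : ℤ_[p])
  set Y : ℤ_[p] := (y.val : ℤ_[p])
  have hX : PadicInt.toZMod X = x := by simp [X]
  have hY : PadicInt.toZMod Y = y := by simp [Y]
  have hlt : ‖X ^ 2 - ε' * Y ^ 2 - a'‖ < 1 := by
    rw [← PadicInt.mem_nonunits, ← IsLocalRing.mem_maximalIdeal, ← PadicInt.ker_toZMod,
      RingHom.mem_ker]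
    simp only [map_sub, map_mul, map_pow, hX, hY]
    simp at hxy
    linear_combination hxy
  have ha0 : a ≠ 0 := by rintro rfl; simp at ha
  obtain ⟨w, hw, -⟩ := exists_sq_eq_of_norm_sub_one_lt hp
    (h := ((X : ℚ_[p]) ^ 2 - ε * (Y : ℚ_[p]) ^ 2) / a) (by
      rw [div_sub_one ha0, norm_div, ha, div_one]
      rw [PadicInt.norm_def] at hlt
      push_cast at hlt
      exact hlt)
  have hw0 : w ≠ 0 := by
    rintro rfl
    have h0 : ((X : ℚ_[p]) ^ 2 - ε * (Y : ℚ_[p]) ^ 2) = 0 := by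
      have := hw.symm
      simpa [ha0] using this
    rw [PadicInt.norm_def] at hlt
    push_cast at hlt
    change ‖(X : ℚ_[p]) ^ 2 - ε * (Y : ℚ_[p]) ^ 2 - a‖ < 1 at hlt
    rw [h0, zero_sub, norm_neg, ha] at hlt
    exact lt_irrefl _ hlt
  refine ⟨(X / w, Y / w), ?_⟩
  rw [eq_div_iff ha0] at hw
  simp only
  field_simp
  linear_combination -hw

theorem exists_sq_sub_mul_sq_eq_of_even_valuation {p : ℕ} [Fact p.Prime] (hp : p ≠ 2) {ε : ℚ_[p]}
    (hε : ‖ε‖ = 1) {a : ℚ_[p]} (ha : a ≠ 0) (hv : Even a.valuation) :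
    ∃ q : ℚ_[p] × ℚ_[p], q.1 ^ 2 - ε * q.2 ^ 2 = a := by
  obtain ⟨k, hk⟩ := hv
  have hp0 : (p : ℚ_[p]) ≠ 0 := by exact_mod_cast (Fact.out : p.Prime).ne_zero
  have hp1 : (p : ℝ) ≠ 0 := by exact_mod_cast (Fact.out : p.Prime).ne_zero
  obtain ⟨q, hq⟩ := exists_sq_sub_mul_sq_eq_of_norm_eq_one hp hε
    (a := a / (p : ℚ_[p]) ^ a.valuation) (by
      rw [norm_div, Padic.norm_eq_zpow_neg_valuation ha, Padic.norm_p_zpow,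
        div_self (zpow_ne_zero _ hp1)])
  refine ⟨((p : ℚ_[p]) ^ k * q.1, (p : ℚ_[p]) ^ k * q.2), ?_⟩
  rw [eq_div_iff (zpow_ne_zero _ hp0), hk, zpow_add₀ hp0] at hq
  linear_combination hq

theorem IsLocallyConstant.exists_dist_lt_imp_eq {X Y : Type*} [PseudoMetricSpace X] [Zero Y]
    {f : X → Y} (hf : IsLocallyConstant f) (hc : HasCompactSupport f) :
    ∃ δ > 0, ∀ x y, dist x y < δ → f x = f y := by
  obtain ⟨δ, hδ, h⟩ := lebesgue_number_lemma_of_metric (c := fun z : Y => f ⁻¹' {z}) hc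
    (fun z => hf.isOpen_fiber z) (fun x _ => Set.mem_iUnion.2 ⟨f x, rfl⟩)
  have key : ∀ x ∈ tsupport f, ∀ y, dist x y < δ → f x = f y := by
    intro x hx y hxy
    obtain ⟨z, hz⟩ := h x hx
    have h1 : f x = z := hz (Metric.mem_ball_self hδ)
    have h2 : f y = z := hz (Metric.mem_ball'.2 hxy)
    rw [h1, h2]
  refine ⟨δ, hδ, fun x y hxy => ?_⟩
  by_cases hx : x ∈ tsupport f
  · exact key x hx y hxy
  by_cases hy : y ∈ tsupport f
  · exact (key y hy x (by rwa [dist_comm])).symm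
  rw [image_eq_zero_of_notMem_tsupport hx, image_eq_zero_of_notMem_tsupport hy]

theorem exists_map_addEquiv_eq_smul {G : Type*} [NormedAddCommGroup G] [ProperSpace G]
    [MeasurableSpace G] [BorelSpace G] (ν : Measure G) [ν.IsAddHaarMeasure] (L : G ≃+ G) {r : ℝ}
    (hr : 0 < r) (hL : ∀ q, ‖L q‖ = r * ‖q‖) :
    ∃ c : NNReal, ν.map L = c • ν ∧
      ∀ s, ν.real (Metric.closedBall 0 s) = c * ν.real (Metric.closedBall 0 (r * s)) := by
  have hc : Continuous L := AddMonoidHomClass.continuous_of_bound L r fun q => (hL q).le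
  have hc' : Continuous L.symm := by
    refine AddMonoidHomClass.continuous_of_bound L.symm r⁻¹ fun q => le_of_eq ?_
    rw [eq_inv_mul_iff_mul_eq₀ hr.ne', ← hL, L.apply_symm_apply]
  have : (ν.map L).IsAddHaarMeasure := L.isAddHaarMeasure_map ν hc hc'
  have hmap := Measure.isAddLeftInvariant_eq_smul (ν.map L) ν
  refine ⟨_, hmap, fun s => ?_⟩
  have h := congrArg (fun m : Measure G => m.real (Metric.closedBall 0 (r * s))) hmap
  simp only [measureReal_nnreal_smul_apply] at h
  rw [← h, map_measureReal_apply hc.measurable Metric.isClosed_closedBall.measurableSet]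
  congr 1
  ext q
  simp [hL, mul_le_mul_iff_right₀ hr]

theorem measureReal_closedBall_norm_pos {p : ℕ} [Fact p.Prime] [MeasurableSpace ℚ_[p]]
    (μ : Measure ℚ_[p]) [μ.IsAddHaarMeasure] {t : ℚ_[p]} (ht : t ≠ 0) :
    0 < μ.real (Metric.closedBall 0 ‖t‖) :=
  ENNReal.toReal_pos (Metric.measure_closedBall_pos μ 0 (norm_pos_iff.2 ht)).ne'
    measure_closedBall_lt_top.ne

theorem measureReal_closedBall_zero_one {p : ℕ} [Fact p.Prime] [MeasurableSpace ℚ_[p]]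
    (μ : Measure ℚ_[p]) (hμ : μ {x : ℚ_[p] | ‖x‖ ≤ 1} = 1) :
    μ.real (Metric.closedBall 0 1) = 1 := by
  have : Metric.closedBall (0 : ℚ_[p]) 1 = {x | ‖x‖ ≤ 1} := by ext; simp
  simp [measureReal_def, this, hμ]

section

variable {p : ℕ} [Fact p.Prime] [MeasurableSpace ℚ_[p]] [BorelSpace ℚ_[p]]
  (μ : Measure ℚ_[p]) [μ.IsAddHaarMeasure]

theorem exists_map_mul_right_eq_smul (hμ : μ {x : ℚ_[p] | ‖x‖ ≤ 1} = 1) {t : ℚ_[p]}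
    (ht : t ≠ 0) : ∃ c : NNReal, μ.map (fun x => x * t) = c • μ ∧
      c * μ.real (Metric.closedBall 0 ‖t‖) = 1 ∧
      ∀ s, μ.real (Metric.closedBall 0 (‖t‖ * s)) =
        μ.real (Metric.closedBall 0 ‖t‖) * μ.real (Metric.closedBall 0 s) := by
  have h1 := measureReal_closedBall_zero_one μ hμ
  obtain ⟨c, hc, h⟩ := exists_map_addEquiv_eq_smul μ (AddAut.mulRight (Units.mk0 t ht))
    (norm_pos_iff.2 ht) (fun q => by simp [mul_comm])
  have h2 := h 1
  rw [h1, mul_one] at h2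
  refine ⟨c, hc, h2.symm, fun s => ?_⟩
  have hc0 : (c : ℝ) ≠ 0 := left_ne_zero_of_mul_eq_one h2.symm
  apply mul_left_cancel₀ hc0
  rw [← h, ← mul_assoc, ← h2, one_mul]

theorem integral_comp_mul_right_padic (hμ : μ {x : ℚ_[p] | ‖x‖ ≤ 1} = 1) {t : ℚ_[p]} (ht : t ≠ 0)
    (f : ℚ_[p] → ℂ) :
    ∫ x, f (x * t) ∂μ = ∫ x, ((μ.real (Metric.closedBall 0 ‖t‖))⁻¹ : ℝ) * f x ∂μ := by
  obtain ⟨c, hc, h, -⟩ := exists_map_mul_right_eq_smul μ hμ ht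
  have h1 := integral_map_equiv (μ := μ) (Homeomorph.mulRight₀ t ht).toMeasurableEquiv f
  rw [integral_const_mul, ← eq_inv_of_mul_eq_one_left h]
  simp only [Homeomorph.toMeasurableEquiv_coe, Homeomorph.coe_mulRight₀] at h1
  rw [← h1, hc, integral_smul_nnreal_measure]
  rfl

theorem integrable_comp_mul_right_padic (hμ : μ {x : ℚ_[p] | ‖x‖ ≤ 1} = 1) {t : ℚ_[p]}
    (ht : t ≠ 0) {f : ℚ_[p] → ℂ} (hf : Integrable (fun x => f (x * t)) μ) : Integrable f μ := by
  obtain ⟨c, hc, h, -⟩ := exists_map_mul_right_eq_smul μ hμ ht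
  have h1 := integrable_map_equiv (μ := μ) (Homeomorph.mulRight₀ t ht).toMeasurableEquiv f
  simp only [Homeomorph.toMeasurableEquiv_coe, Homeomorph.coe_mulRight₀] at h1
  have h2 := h1.2 hf
  rw [hc] at h2
  have hc0 : c ≠ 0 := by rintro rfl; simp at h
  exact (integrable_smul_measure (c := (c : ENNReal)) (by simpa) (by simp)).1 h2

theorem measurable_measureReal_closedBall_norm :
    Measurable fun ξ : ℚ_[p] => μ.real (Metric.closedBall 0 ‖ξ‖) := by
  have : Monotone fun r : ℝ => μ.real (Metric.closedBall (0 : ℚ_[p]) r) := fun r s h =>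
    measureReal_mono (Metric.closedBall_subset_closedBall h) measure_closedBall_lt_top.ne
  exact this.measurable.comp measurable_norm

theorem exists_map_prod_eq_smul (hμ : μ {x : ℚ_[p] | ‖x‖ ≤ 1} = 1)
    (L : ℚ_[p] × ℚ_[p] ≃+ ℚ_[p] × ℚ_[p]) {t : ℚ_[p]} (ht : t ≠ 0)
    (hL : ∀ q, ‖L q‖ = ‖t‖ * ‖q‖) :
    ∃ c : NNReal, (μ.prod μ).map L = c • μ.prod μ ∧
      c * μ.real (Metric.closedBall 0 ‖t ^ 2‖) = 1 := by
  obtain ⟨-, -, -, hm⟩ := exists_map_mul_right_eq_smul μ hμ ht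
  have h1 := measureReal_closedBall_zero_one μ hμ
  obtain ⟨c, hc, h⟩ := exists_map_addEquiv_eq_smul (μ.prod μ) L (norm_pos_iff.2 ht) hL
  refine ⟨c, hc, ?_⟩
  have h2 := h 1
  rw [← Prod.mk_zero_zero, ← closedBall_prod_same, ← closedBall_prod_same, measureReal_prod_prod,
    measureReal_prod_prod, h1, mul_one, mul_one] at h2
  rw [h2, norm_pow, sq, hm]

end

theorem setIntegral_preimage_eq_setIntegral_density {p : ℕ} [Fact p.Prime]
    [MeasurableSpace ℚ_[p]] [BorelSpace ℚ_[p]] (μ : Measure ℚ_[p]) [μ.IsAddHaarMeasure]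
    (hμ : μ {x : ℚ_[p] | ‖x‖ ≤ 1} = 1) {X : Type*} [MeasurableSpace X] (ν : Measure X) [SFinite ν]
    {Q : X → ℚ_[p]} (hQ : Measurable Q) (hQ0 : ∀ᵐ q ∂ν, Q q ≠ 0) {Φ : X → ℂ}
    (hΦ : Integrable Φ ν) {ρ : ℝ} (hρ1 : ρ < 1)
    (hinv : ∀ h ∈ Metric.closedBall (1 : ℚ_[p]) ρ, ∀ E : Set ℚ_[p], MeasurableSet E →
      ∫ q in {q | h * Q q ∈ E}, Φ q ∂ν = ∫ q in {q | Q q ∈ E}, Φ q ∂ν)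
    {E : Set ℚ_[p]} (hE : MeasurableSet E) :
    (μ.real (Metric.closedBall 1 ρ) : ℂ) * ∫ q in {q | Q q ∈ E}, Φ q ∂ν =
      ∫ ξ in E, ((μ.real (Metric.closedBall 0 ‖ξ‖))⁻¹ : ℝ) *
        ∫ q in {q | ‖Q q - ξ‖ ≤ ρ * ‖ξ‖}, Φ q ∂ν ∂μ := by
  set H : Set ℚ_[p] := Metric.closedBall 1 ρ with hH
  have hHm : MeasurableSet H := Metric.isClosed_closedBall.measurableSet
  have : IsFiniteMeasure (μ.restrict H) :=
    isFiniteMeasure_restrict.2 measure_closedBall_lt_top.ne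
  set e : ℚ_[p] → ℂ := E.indicator 1
  have hem : Measurable e := measurable_one.indicator hE
  have hen : ∀ x, ‖e x‖ ≤ 1 := fun x => by
    by_cases hx : x ∈ E <;> simp [e, hx]
  let V : ℚ_[p] → ℝ := fun ξ => (μ.real (Metric.closedBall 0 ‖ξ‖))⁻¹
  have hVm : Measurable V := (measurable_measureReal_closedBall_norm μ).inv
  let S : Set (X × ℚ_[p]) := {z | ‖Q z.1 - z.2‖ ≤ ρ * ‖z.2‖}
  have hS : MeasurableSet S := by
    refine measurableSet_le ?_ ?_ <;> fun_prop
  let s : X × ℚ_[p] → ℂ := S.indicator 1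
  have hsm : Measurable s := measurable_one.indicator hS
  have hset : ∀ h, ∫ q in {q | h * Q q ∈ E}, Φ q ∂ν = ∫ q, e (h * Q q) * Φ q ∂ν := by
    intro h
    have hm : MeasurableSet {q | h * Q q ∈ E} := hE.preimage (hQ.const_mul h)
    rw [← integral_indicator hm]
    refine integral_congr_ae (.of_forall fun q => ?_)
    by_cases hq : h * Q q ∈ E <;> simp [e, hq, Set.indicator]
  have hsub : ∀ (f : ℚ_[p] → ℂ) (q : X), Q q ≠ 0 →
      (fun h => (H.indicator 1 (h * Q q / Q q) : ℂ) * f (h * Q q)) =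
        H.indicator fun h => f (h * Q q) := by
    intro f q hq
    ext h
    rw [mul_div_cancel_right₀ _ hq]
    by_cases hh : h ∈ H <;> simp [hh]
  have hsV : ∀ (f : ℚ_[p] → ℂ) (q : X), Q q ≠ 0 → ∀ ξ,
      ((μ.real (Metric.closedBall 0 ‖Q q‖))⁻¹ : ℝ) * ((H.indicator 1 (ξ / Q q) : ℂ) * f ξ) =
        f ξ * (V ξ * s (q, ξ)) := by
    intro f q hq ξ
    have hq' : 0 < ‖Q q‖ := norm_pos_iff.2 hq
    have hmem : ξ / Q q ∈ H ↔ ‖Q q - ξ‖ ≤ ρ * ‖Q q‖ := by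
      rw [hH, mem_closedBall_iff_norm, div_sub_one hq, norm_div, div_le_iff₀ hq', norm_sub_rev]
    by_cases hξ : ‖Q q‖ = ‖ξ‖
    · have : ξ / Q q ∈ H ↔ (q, ξ) ∈ S := by rw [hmem, hξ]; rfl
      by_cases hz : (q, ξ) ∈ S
      · simp [s, hz, this.2 hz, V, hξ, mul_comm]
      · simp [s, hz, mt this.1 hz]
    · have hn : ‖Q q - ξ‖ = max ‖Q q‖ ‖ξ‖ := by
        rw [sub_eq_add_neg, IsUltrametricDist.norm_add_eq_max_of_norm_ne_norm (by simpa), norm_neg]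
      have h1 : ξ / Q q ∉ H := by
        rw [hmem, hn, not_le]
        exact (mul_lt_of_lt_one_left hq' hρ1).trans_le (le_max_left _ _)
      have h2 : (q, ξ) ∉ S := by
        change ¬ ‖Q q - ξ‖ ≤ ρ * ‖ξ‖
        rw [hn, not_le]
        rcases eq_or_ne ξ 0 with rfl | hξ0
        · simpa using hq
        · exact (mul_lt_of_lt_one_left (norm_pos_iff.2 hξ0) hρ1).trans_le (le_max_right _ _)
      simp [s, h1, h2]
  have hfib : ∀ (f : ℚ_[p] → ℂ) (q : X), Q q ≠ 0 →
      ∫ h in H, f (h * Q q) ∂μ = ∫ ξ, f ξ * (V ξ * s (q, ξ)) ∂μ := by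
    intro f q hq
    rw [← integral_indicator hHm, ← hsub f q hq,
      integral_comp_mul_right_padic μ hμ hq fun ξ => (H.indicator 1 (ξ / Q q) : ℂ) * f ξ]
    simp only [hsV f q hq]
  have hfibi : ∀ q : X, Q q ≠ 0 → Integrable (fun ξ => (V ξ : ℂ) * s (q, ξ)) μ := by
    intro q hq
    have h1 : Integrable (fun ξ => (H.indicator 1 (ξ / Q q) : ℂ) * 1) μ := by
      refine integrable_comp_mul_right_padic μ hμ hq ?_
      rw [hsub (fun _ => 1) q hq]
      exact (integrable_indicator_iff hHm).2 (integrable_const (μ := μ.restrict H) (1 : ℂ))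
    have h2 := h1.const_mul (((μ.real (Metric.closedBall 0 ‖Q q‖))⁻¹ : ℝ) : ℂ)
    simp only [hsV (fun _ => 1) q hq, one_mul] at h2
    exact h2
  have hint1 : Integrable (fun z : ℚ_[p] × X => e (z.1 * Q z.2) * Φ z.2)
      ((μ.restrict H).prod ν) := by
    refine (hΦ.comp_snd (μ.restrict H)).bdd_mul (c := 1) ?_ (.of_forall fun z => hen _)
    exact (hem.comp (by fun_prop)).aestronglyMeasurable
  have hint2 : Integrable (fun z : X × ℚ_[p] => (V z.2 * s z) * Φ z.1) (ν.prod μ) := by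
    have hmeas : AEStronglyMeasurable (fun z : X × ℚ_[p] => (V z.2 * s z) * Φ z.1)
        (ν.prod μ) := by
      refine AEStronglyMeasurable.mul ?_ hΦ.aestronglyMeasurable.comp_fst
      refine Measurable.aestronglyMeasurable ?_
      fun_prop
    refine (integrable_prod_iff hmeas).2 ⟨?_, ?_⟩
    · filter_upwards [hQ0] with q hq
      exact (hfibi q hq).mul_const _
    · refine (hΦ.norm.const_mul (μ.real H)).congr ?_
      filter_upwards [hQ0] with q hq
      have h1 := hfib (fun _ => 1) q hq
      simp only [integral_const, one_mul, measureReal_restrict_apply_univ] at h1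
      have h2 : ∀ ξ, ‖(V ξ : ℂ) * s (q, ξ)‖ = V ξ * S.indicator 1 (q, ξ) := by
        intro ξ
        have : 0 ≤ V ξ := inv_nonneg.2 measureReal_nonneg
        by_cases hz : (q, ξ) ∈ S <;> simp [s, hz, abs_of_nonneg this]
      have h3 : ∀ ξ, (V ξ : ℂ) * s (q, ξ) = ((V ξ * S.indicator 1 (q, ξ) : ℝ) : ℂ) := by
        intro ξ
        by_cases hz : (q, ξ) ∈ S <;> simp [s, hz]
      simp only [norm_mul] at h2 ⊢
      simp only [h2]
      simp only [h3] at h1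
      rw [integral_mul_const]
      congr 1
      rw [integral_complex_ofReal] at h1
      simpa using h1
  have hint3 : Integrable (Function.uncurry fun (q : X) (ξ : ℚ_[p]) =>
      e ξ * ((V ξ * s (q, ξ)) * Φ q)) (ν.prod μ) :=
    hint2.bdd_mul (c := 1) (hem.comp measurable_snd).aestronglyMeasurable
      (.of_forall fun z => hen _)
  calc (μ.real H : ℂ) * ∫ q in {q | Q q ∈ E}, Φ q ∂ν
      = ∫ h in H, ∫ q, e (h * Q q) * Φ q ∂ν ∂μ := by
        rw [setIntegral_congr_fun hHm (g := fun _ => ∫ q in {q | Q q ∈ E}, Φ q ∂ν)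
          fun h hh => by rw [← hinv h hh E hE, hset]]
        simp
    _ = ∫ q, ∫ h in H, e (h * Q q) * Φ q ∂μ ∂ν := integral_integral_swap hint1
    _ = ∫ q, ∫ ξ, e ξ * ((V ξ * s (q, ξ)) * Φ q) ∂μ ∂ν := by
        refine integral_congr_ae ?_
        filter_upwards [hQ0] with q hq
        simp only [integral_mul_const, hfib e q hq, ← mul_assoc]
    _ = ∫ ξ, ∫ q, e ξ * ((V ξ * s (q, ξ)) * Φ q) ∂ν ∂μ := integral_integral_swap hint3
    _ = _ := by
        rw [← integral_indicator hE]
        refine integral_congr_ae (.of_forall fun ξ => ?_)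
        have h1 : ∫ q in {q | ‖Q q - ξ‖ ≤ ρ * ‖ξ‖}, Φ q ∂ν = ∫ q, s (q, ξ) * Φ q ∂ν := by
          rw [← integral_indicator (measurableSet_le (by fun_prop) (by fun_prop))]
          refine integral_congr_ae (.of_forall fun q => ?_)
          by_cases hz : ‖Q q - ξ‖ ≤ ρ * ‖ξ‖ <;> simp [s, S, hz, Set.indicator]
        simp only [mul_assoc, integral_const_mul, ← h1]
        by_cases hξ : ξ ∈ E <;> simp [e, hξ, V]

theorem Padic.norm_eq_of_norm_sub_le_mul {p : ℕ} [Fact p.Prime] {a ξ : ℚ_[p]} {ρ : ℝ} (hρ : ρ < 1)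
    (hξ : ξ ≠ 0) (h : ‖a - ξ‖ ≤ ρ * ‖ξ‖) : ‖a‖ = ‖ξ‖ := by
  have h1 : ‖a - ξ‖ < ‖ξ‖ := h.trans_lt (mul_lt_of_lt_one_left (norm_pos_iff.2 hξ) hρ)
  rw [← sub_add_cancel a ξ, IsUltrametricDist.norm_add_eq_max_of_norm_ne_norm h1.ne,
    max_eq_right h1.le]

theorem Padic.even_valuation_of_norm_sq_eq {p : ℕ} [Fact p.Prime] {t ξ : ℚ_[p]} (hξ : ξ ≠ 0)
    (h : ‖t‖ ^ 2 = ‖ξ‖) : Even ξ.valuation := by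
  have ht : t ≠ 0 := by
    rintro rfl
    exact hξ (by simpa using h.symm)
  have hp : (1 : ℝ) < p := by exact_mod_cast (Fact.out : p.Prime).one_lt
  rw [Padic.norm_eq_zpow_neg_valuation ht, Padic.norm_eq_zpow_neg_valuation hξ, sq,
    ← zpow_add₀ (by positivity)] at h
  have := zpow_right_injective₀ (by positivity) hp.ne' h
  exact ⟨t.valuation, by omega⟩

theorem exists_norm_eq_norm_prod {E : Type*} [Norm E] (q : E × E) : ∃ t : E, ‖t‖ = ‖q‖ := by
  rcases max_choice ‖q.1‖ ‖q.2‖ with h | h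
  exacts [⟨q.1, h.symm⟩, ⟨q.2, h.symm⟩]

/-- Multiplication by `a.1 + a.2 √ε` in the basis `1, √ε`. -/
def quadraticMulAddEquiv {K : Type*} [Field K] (ε : K) (a : K × K)
    (ha : a.1 ^ 2 - ε * a.2 ^ 2 ≠ 0) : K × K ≃+ K × K where
  toFun q := (a.1 * q.1 + ε * a.2 * q.2, a.2 * q.1 + a.1 * q.2)
  invFun q := ((a.1 * q.1 - ε * a.2 * q.2) / (a.1 ^ 2 - ε * a.2 ^ 2),
    (a.1 * q.2 - a.2 * q.1) / (a.1 ^ 2 - ε * a.2 ^ 2))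
  left_inv q := by
    ext
    · rw [div_eq_iff ha]; ring
    · rw [div_eq_iff ha]; ring
  right_inv q := by
    ext
    · simp only [← mul_div_assoc, ← add_div]
      rw [div_eq_iff ha]; ring
    · simp only [← mul_div_assoc, ← add_div]
      rw [div_eq_iff ha]; ring
  map_add' q r := by
    ext
    · simp only [Prod.fst_add, Prod.snd_add]; ring
    · simp only [Prod.fst_add, Prod.snd_add]; ring

theorem quadraticMulAddEquiv_norm_form {K : Type*} [Field K] (ε : K) (a : K × K)
    (ha : a.1 ^ 2 - ε * a.2 ^ 2 ≠ 0) (q : K × K) :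
    (quadraticMulAddEquiv ε a ha q).1 ^ 2 - ε * (quadraticMulAddEquiv ε a ha q).2 ^ 2 =
      (a.1 ^ 2 - ε * a.2 ^ 2) * (q.1 ^ 2 - ε * q.2 ^ 2) := by
  simp only [quadraticMulAddEquiv, AddEquiv.coe_mk, Equiv.coe_fn_mk]
  ring

section

variable {p : ℕ} [Fact p.Prime] [MeasurableSpace ℚ_[p]] [BorelSpace ℚ_[p]]
  (μ : Measure ℚ_[p]) [μ.IsAddHaarMeasure]

theorem measurable_quadraticMulAddEquiv {ε : ℚ_[p]} (a : ℚ_[p] × ℚ_[p])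
    (ha : a.1 ^ 2 - ε * a.2 ^ 2 ≠ 0) : Measurable (quadraticMulAddEquiv ε a ha) := by
  change Measurable fun q : ℚ_[p] × ℚ_[p] =>
    (a.1 * q.1 + ε * a.2 * q.2, a.2 * q.1 + a.1 * q.2)
  fun_prop

theorem exists_map_quadraticMulAddEquiv_eq_smul (hp : p ≠ 2)
    (hμ : μ {x : ℚ_[p] | ‖x‖ ≤ 1} = 1) {ε : ℚ_[p]} (hε : ‖ε‖ = 1)
    (hεsq : ¬∃ y : ℚ_[p], y ^ 2 = ε) (a : ℚ_[p] × ℚ_[p]) (ha : a.1 ^ 2 - ε * a.2 ^ 2 ≠ 0) :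
    ∃ c : NNReal, (μ.prod μ).map (quadraticMulAddEquiv ε a ha) = c • μ.prod μ ∧
      c * μ.real (Metric.closedBall 0 ‖a.1 ^ 2 - ε * a.2 ^ 2‖) = 1 := by
  obtain ⟨t, ht⟩ := exists_norm_eq_norm_prod a
  have ht0 : t ≠ 0 := by
    rintro rfl
    rw [norm_zero] at ht
    apply ha
    rw [← norm_eq_zero, norm_sq_sub_mul_sq hp hε hεsq, ← ht]
    simp
  rw [norm_sq_sub_mul_sq hp hε hεsq, ← ht, ← norm_pow]
  refine exists_map_prod_eq_smul μ hμ _ ht0 fun q => ?_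
  rw [← sq_eq_sq₀ (norm_nonneg _) (by positivity), ← norm_sq_sub_mul_sq hp hε hεsq,
    quadraticMulAddEquiv_norm_form, norm_mul, norm_sq_sub_mul_sq hp hε hεsq,
    norm_sq_sub_mul_sq hp hε hεsq, ht, mul_pow]

theorem measureReal_norm_form_near_value (hp : p ≠ 2)
    (hμ : μ {x : ℚ_[p] | ‖x‖ ≤ 1} = 1) {ε : ℚ_[p]} (hε : ‖ε‖ = 1)
    (hεsq : ¬∃ y : ℚ_[p], y ^ 2 = ε) (a : ℚ_[p] × ℚ_[p]) (ha : a.1 ^ 2 - ε * a.2 ^ 2 ≠ 0)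
    (ρ : ℝ) :
    (μ.prod μ).real {q | ‖q.1 ^ 2 - ε * q.2 ^ 2 - (a.1 ^ 2 - ε * a.2 ^ 2)‖ ≤
        ρ * ‖a.1 ^ 2 - ε * a.2 ^ 2‖} =
      μ.real (Metric.closedBall 0 ‖a.1 ^ 2 - ε * a.2 ^ 2‖) *
        (μ.prod μ).real {q | ‖q.1 ^ 2 - ε * q.2 ^ 2 - 1‖ ≤ ρ} := by
  obtain ⟨c, hc, hcV⟩ := exists_map_quadraticMulAddEquiv_eq_smul μ hp hμ hε hεsq a ha
  set N := a.1 ^ 2 - ε * a.2 ^ 2 with hN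
  set S : Set (ℚ_[p] × ℚ_[p]) := {q | ‖q.1 ^ 2 - ε * q.2 ^ 2 - N‖ ≤ ρ * ‖N‖}
  have hS : MeasurableSet S := measurableSet_le (by fun_prop) (by fun_prop)
  have h1 := congrArg (fun m : Measure (ℚ_[p] × ℚ_[p]) => m.real S) hc
  simp only [measureReal_nnreal_smul_apply] at h1
  rw [map_measureReal_apply (measurable_quadraticMulAddEquiv a ha) hS] at h1
  have h2 : quadraticMulAddEquiv ε a ha ⁻¹' S = {q | ‖q.1 ^ 2 - ε * q.2 ^ 2 - 1‖ ≤ ρ} := by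
    ext q
    simp only [S, Set.mem_preimage, Set.mem_ofPred_eq, quadraticMulAddEquiv_norm_form, ← hN]
    rw [← mul_sub_one, norm_mul, mul_comm, mul_le_mul_iff_left₀ (norm_pos_iff.2 ha)]
  rw [← h2, h1, ← mul_assoc, mul_comm _ (c : ℝ), hcV, one_mul]

theorem setIntegral_norm_form_mul_eq (hp : p ≠ 2)
    (hμ : μ {x : ℚ_[p] | ‖x‖ ≤ 1} = 1) {ε : ℚ_[p]} (hε : ‖ε‖ = 1)
    (hεsq : ¬∃ y : ℚ_[p], y ^ 2 = ε) {Φ : ℚ_[p] × ℚ_[p] → ℂ} {w : ℚ_[p]} (hw : ‖w‖ = 1)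
    (hΦ : ∀ q, Φ (w • q) = Φ q) (E : Set ℚ_[p]) :
    ∫ q in {q : ℚ_[p] × ℚ_[p] | w ^ 2 * (q.1 ^ 2 - ε * q.2 ^ 2) ∈ E}, Φ q ∂(μ.prod μ) =
      ∫ q in {q : ℚ_[p] × ℚ_[p] | q.1 ^ 2 - ε * q.2 ^ 2 ∈ E}, Φ q ∂(μ.prod μ) := by
  have hw0 : w ≠ 0 := by rintro rfl; simp at hw
  have h1 := measureReal_closedBall_zero_one μ hμ
  have ha : (w, (0 : ℚ_[p])).1 ^ 2 - ε * (w, (0 : ℚ_[p])).2 ^ 2 ≠ 0 := by simpa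
  obtain ⟨c, hc, hcV⟩ := exists_map_quadraticMulAddEquiv_eq_smul μ hp hμ hε hεsq (w, 0) ha
  have hc1 : c = 1 := by simpa [hw, h1] using hcV
  rw [hc1, one_smul] at hc
  have hL : ∀ q, quadraticMulAddEquiv ε (w, 0) ha q = w • q := fun q => by
    ext <;> simp [quadraticMulAddEquiv]
  have hmp : MeasurePreserving (quadraticMulAddEquiv ε (w, 0) ha) (μ.prod μ) (μ.prod μ) :=
    ⟨measurable_quadraticMulAddEquiv _ ha, hc⟩
  have hemb : MeasurableEmbedding (quadraticMulAddEquiv ε (w, 0) ha) := by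
    have : Continuous (quadraticMulAddEquiv ε (w, 0) ha) :=
      (continuous_const_smul w).congr fun q => (hL q).symm
    exact this.measurableEmbedding (AddEquiv.injective _)
  rw [← hmp.setIntegral_preimage_emb hemb Φ {q | q.1 ^ 2 - ε * q.2 ^ 2 ∈ E}]
  simp only [hL, hΦ]
  congr 2
  ext q
  simp only [Set.mem_ofPred_eq, Set.mem_preimage, hL, Prod.smul_fst, Prod.smul_snd, smul_eq_mul]
  ring_nf

end

/-- Non-Archimedean nonsplit germ expansion (`p` odd, `Q(x,y) = x² − εy²` the unramified norm
form): the push-forward of a Schwartz–Bruhat measure on `ℚ_p²` under `Q` has density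
`C₁(ξ) + C₂(ξ)·(−1)^{v(ξ)}` with respect to Haar measure, with `C₁, C₂` Schwartz–Bruhat. -/
theorem stmt_12 (p : ℕ) [Fact p.Prime] (hp : p ≠ 2)
    [MeasurableSpace ℚ_[p]] [BorelSpace ℚ_[p]]
    (μ : Measure ℚ_[p]) [μ.IsAddHaarMeasure]
    (hμ : μ {x : ℚ_[p] | ‖x‖ ≤ 1} = 1)
    (ε : ℚ_[p]) (hε : ‖ε‖ = 1) (hεsq : ¬∃ y : ℚ_[p], y ^ 2 = ε)
    (Φ : ℚ_[p] × ℚ_[p] → ℂ) (hΦ : IsLocallyConstant Φ) (hΦc : HasCompactSupport Φ) :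
    ∃ C₁ C₂ : ℚ_[p] → ℂ,
      IsLocallyConstant C₁ ∧ HasCompactSupport C₁ ∧
      IsLocallyConstant C₂ ∧ HasCompactSupport C₂ ∧
      ∀ E : Set ℚ_[p], MeasurableSet E →
        (∫ q in {q : ℚ_[p] × ℚ_[p] | q.1 ^ 2 - ε * q.2 ^ 2 ∈ E}, Φ q ∂(μ.prod μ)) =
          ∫ ξ in E, (C₁ ξ + C₂ ξ * (-1 : ℂ) ^ ξ.valuation) ∂μ := by
  have hN := norm_sq_sub_mul_sq hp hε hεsq
  obtain ⟨δ, hδ, hΦδ⟩ := hΦ.exists_dist_lt_imp_eq hΦc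
  obtain ⟨R, hR, hΦR⟩ : ∃ R > 0, ∀ q, R < ‖q‖ → Φ q = 0 := by
    obtain ⟨R, hR, hR'⟩ := (hΦc : IsCompact (tsupport Φ)).isBounded.exists_pos_norm_le
    exact ⟨R, hR, fun q hq => image_eq_zero_of_notMem_tsupport fun h => (hR' q h).not_gt hq⟩
  obtain ⟨ρ, hρ0, hρ1, hρR⟩ : ∃ ρ > 0, ρ < 1 ∧ ρ * R < δ := by
    refine ⟨min (1 / 2) (δ / (2 * R)), by positivity, ?_, ?_⟩
    · exact (min_le_left _ _).trans_lt (by norm_num)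
    · calc min (1 / 2) (δ / (2 * R)) * R ≤ δ / (2 * R) * R := by
            gcongr; exact min_le_right _ _
        _ = δ / 2 := by field_simp
        _ < δ := half_lt_self hδ
  have hΦi : Integrable Φ (μ.prod μ) := hΦ.continuous.integrable_of_hasCompactSupport hΦc
  have hinv : ∀ h ∈ Metric.closedBall (1 : ℚ_[p]) ρ, ∀ E : Set ℚ_[p], MeasurableSet E →
      ∫ q in {q : ℚ_[p] × ℚ_[p] | h * (q.1 ^ 2 - ε * q.2 ^ 2) ∈ E}, Φ q ∂(μ.prod μ) =
        ∫ q in {q : ℚ_[p] × ℚ_[p] | q.1 ^ 2 - ε * q.2 ^ 2 ∈ E}, Φ q ∂(μ.prod μ) := by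
    intro h hh E _
    rw [mem_closedBall_iff_norm] at hh
    obtain ⟨w, rfl, hw⟩ := exists_sq_eq_of_norm_sub_one_lt hp (hh.trans_lt hρ1)
    rw [← hw] at hh
    have hw1 : ‖w‖ = 1 := by
      simpa using Padic.norm_eq_of_norm_sub_le_mul hρ1 one_ne_zero (by simpa using hh)
    refine setIntegral_norm_form_mul_eq μ hp hμ hε hεsq hw1 (fun q => ?_) E
    rcases le_or_gt ‖q‖ R with hq | hq
    · apply hΦδ
      rw [dist_eq_norm, show w • q - q = (w - 1) • q by rw [sub_smul, one_smul], norm_smul]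
      exact (mul_le_mul hh hq (norm_nonneg _) hρ0.le).trans_lt hρR
    · rw [hΦR q hq, hΦR _ (by rwa [norm_smul, hw1, one_mul])]
  have hQ0 : ∀ᵐ q : ℚ_[p] × ℚ_[p] ∂(μ.prod μ), q.1 ^ 2 - ε * q.2 ^ 2 ≠ 0 := by
    have : ∀ᵐ q : ℚ_[p] × ℚ_[p] ∂(μ.prod μ), q ≠ 0 := by simp [ae_iff]
    filter_upwards [this] with q hq
    rw [← norm_ne_zero_iff, hN]
    exact pow_ne_zero _ (norm_ne_zero_iff.2 hq)
  set m := μ.real (Metric.closedBall (1 : ℚ_[p]) ρ)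
  have hm : (m : ℂ) ≠ 0 := by
    exact_mod_cast (ENNReal.toReal_pos (Metric.measure_closedBall_pos μ 1 hρ0).ne'
      measure_closedBall_lt_top.ne).ne'
  let S : ℚ_[p] → Set (ℚ_[p] × ℚ_[p]) := fun ξ =>
    {q | ‖q.1 ^ 2 - ε * q.2 ^ 2 - ξ‖ ≤ ρ * ‖ξ‖}
  have hSm : ∀ ξ, MeasurableSet (S ξ) := fun ξ => measurableSet_le (by fun_prop) (by fun_prop)
  have hSnorm : ∀ ξ ≠ 0, ∀ q ∈ S ξ, ‖q‖ ^ 2 = ‖ξ‖ := fun ξ hξ q hq => by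
    rw [← hN]
    exact Padic.norm_eq_of_norm_sub_le_mul hρ1 hξ hq
  let D : ℚ_[p] → ℂ := fun ξ =>
    (m : ℂ)⁻¹ * (((μ.real (Metric.closedBall 0 ‖ξ‖))⁻¹ : ℝ) * ∫ q in S ξ, Φ q ∂(μ.prod μ))
  let κ : ℂ := (m : ℂ)⁻¹ *
    ((μ.prod μ).real {q | ‖q.1 ^ 2 - ε * q.2 ^ 2 - 1‖ ≤ ρ} * Φ 0)
  have hDloc : ∀ ξ ≠ 0, ∀ ξ', ‖ξ' - ξ‖ ≤ ρ * ‖ξ‖ → D ξ' = D ξ := by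
    intro ξ hξ ξ' h
    have hn := Padic.norm_eq_of_norm_sub_le_mul hρ1 hξ h
    have hS : S ξ' = S ξ := by
      ext q
      simp only [S, Set.mem_ofPred_eq, hn]
      constructor <;> intro hq
      · rw [← sub_add_sub_cancel _ ξ' ξ]
        exact (IsUltrametricDist.norm_add_le_max _ _).trans (max_le hq h)
      · rw [norm_sub_rev] at h
        rw [← sub_add_sub_cancel _ ξ ξ']
        exact (IsUltrametricDist.norm_add_le_max _ _).trans (max_le hq h)
    simp only [D, hn, hS]
  have hDsupp : ∀ ξ, R ^ 2 < ‖ξ‖ → D ξ = 0 := by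
    intro ξ hξ
    have hξ0 : ξ ≠ 0 := norm_pos_iff.1 (lt_trans (by positivity) hξ)
    have : ∫ q in S ξ, Φ q ∂(μ.prod μ) = 0 :=
      setIntegral_eq_zero_of_forall_eq_zero fun q hq => hΦR q <|
        lt_of_pow_lt_pow_left₀ 2 (norm_nonneg q) (by rwa [hSnorm ξ hξ0 q hq])
    simp [D, this]
  have hDnear : ∀ ξ ≠ 0, ‖ξ‖ < δ ^ 2 → D ξ = κ / 2 + κ / 2 * (-1 : ℂ) ^ ξ.valuation := by
    intro ξ hξ hξδ
    rcases Int.even_or_odd ξ.valuation with hv | hv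
    · obtain ⟨a, rfl⟩ := exists_sq_sub_mul_sq_eq_of_even_valuation hp hε hξ hv
      have h1 : ∫ q in S (a.1 ^ 2 - ε * a.2 ^ 2), Φ q ∂(μ.prod μ) =
          (μ.prod μ).real (S (a.1 ^ 2 - ε * a.2 ^ 2)) * Φ 0 := by
        rw [setIntegral_congr_fun (hSm _) (g := fun _ => Φ 0) fun q hq => hΦδ q 0 ?_]
        · simp
        · rw [dist_zero_right]
          exact lt_of_pow_lt_pow_left₀ 2 hδ.le (by rwa [hSnorm _ hξ q hq])
      have hV := (measureReal_closedBall_norm_pos μ hξ).ne'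
      simp only [D, κ, h1]
      rw [measureReal_norm_form_near_value μ hp hμ hε hεsq a hξ ρ, hv.neg_one_zpow, mul_one,
        add_halves, ← mul_assoc _ _ (Φ 0), ← Complex.ofReal_mul, inv_mul_cancel_left₀ hV]
    · have h1 : S ξ = ∅ := by
        refine Set.eq_empty_of_forall_notMem fun q hq => ?_
        obtain ⟨t, ht⟩ := exists_norm_eq_norm_prod q
        exact (Int.not_even_iff_odd.2 hv)
          (Padic.even_valuation_of_norm_sq_eq hξ (by rw [ht, hSnorm ξ hξ q hq]))
      simp [D, h1, hv.neg_one_zpow]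
  have hnear : ∀ ξ : ℚ_[p], ξ ≠ 0 → ∀ᶠ ξ' in nhds ξ, ‖ξ' - ξ‖ ≤ ρ * ‖ξ‖ := fun ξ hξ => by
    filter_upwards [Metric.closedBall_mem_nhds ξ (mul_pos hρ0 (norm_pos_iff.2 hξ))] with ξ' h
    rwa [← mem_closedBall_iff_norm]
  have hpiece : ∀ f : ℚ_[p] → ℂ, (∀ ξ ≠ 0, ∀ ξ', ‖ξ' - ξ‖ ≤ ρ * ‖ξ‖ → f ξ' = f ξ) →
      (∀ ξ, R ^ 2 < ‖ξ‖ → f ξ = 0) →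
      IsLocallyConstant (fun ξ => if ‖ξ‖ < δ ^ 2 then κ / 2 else f ξ) ∧
        HasCompactSupport (fun ξ => if ‖ξ‖ < δ ^ 2 then κ / 2 else f ξ) := by
    intro f hf hf0
    constructor
    · rw [IsLocallyConstant.iff_eventually_eq]
      intro ξ
      by_cases hξ : ‖ξ‖ < δ ^ 2
      · filter_upwards [continuous_norm.continuousAt.eventually_lt_const hξ] with ξ' h
        simp only [h, hξ, if_true]
      · have hξ0 : ξ ≠ 0 := by
          rintro rfl
          exact hξ (by rw [norm_zero]; positivity)
        filter_upwards [hnear ξ hξ0] with ξ' h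
        rw [Padic.norm_eq_of_norm_sub_le_mul hρ1 hξ0 h, hf ξ hξ0 ξ' h]
    · refine HasCompactSupport.intro (isCompact_closedBall 0 (max (δ ^ 2) (R ^ 2))) fun ξ hξ => ?_
      rw [mem_closedBall_zero_iff, not_le, max_lt_iff] at hξ
      rw [if_neg hξ.1.not_gt, hf0 ξ hξ.2]
  obtain ⟨hC₁, hC₁c⟩ := hpiece D hDloc hDsupp
  obtain ⟨hC₂, hC₂c⟩ := hpiece (fun _ => 0) (fun _ _ _ _ => rfl) (fun _ _ => rfl)
  refine ⟨_, _, hC₁, hC₁c, hC₂, hC₂c, fun E hE => ?_⟩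
  have hmain := setIntegral_preimage_eq_setIntegral_density μ hμ (μ.prod μ)
    (Q := fun q => q.1 ^ 2 - ε * q.2 ^ 2) (by fun_prop) hQ0 hΦi hρ1 hinv hE
  rw [← eq_inv_mul_iff_mul_eq₀ hm, ← integral_const_mul] at hmain
  rw [hmain]
  refine integral_congr_ae (ae_restrict_of_ae ?_)
  have : ∀ᵐ ξ : ℚ_[p] ∂μ, ξ ≠ 0 := by simp [ae_iff]
  filter_upwards [this] with ξ hξ
  change D ξ = _
  by_cases h : ‖ξ‖ < δ ^ 2
  · simp only [h, if_true, hDnear ξ hξ h]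
  · simp only [h, if_false, zero_mul, add_zero]
end

section
/- Let p be a prime, μ an additive Haar measure on ℚ_p normalized so that μ(ℤ_p) = 1, and Φ : ℚ_p × ℚ_p → ℂ a locally constant compactly supported function. Then for every complex s with Re(s) > 0 the integral Z(s) = ∫_{ℚ_p²} Φ(x,y)·‖x·y‖^{s−1} d(μ×μ) converges absolutely (the integrand being taken to be 0 where xy = 0), and there exist M ∈ ℕ and a polynomial P with complex coefficients such that (1 − p^{−s})² · Z(s) = p^{M s} · P(p^{−s}) for all s with Re(s) > 0. In particular Z(s) is a rational function of p^{−s} whose denominator divides (1 − p^{−s})². -/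
open MeasureTheory
open scoped Classical

lemma ofReal_zpow_neg_cpow_sub_one {p : ℕ} (hp : p ≠ 0) (v : ℤ) (s : ℂ) :
    (((p : ℝ) ^ (-v) : ℝ) : ℂ) ^ (s - 1) = (p : ℂ) ^ v * (p : ℂ) ^ (-(v : ℂ) * s) := by
  have hp' : (p : ℂ) ≠ 0 := Nat.cast_ne_zero.mpr hp
  have h0 : (0 : ℝ) < (p : ℝ) ^ (-v) := by positivity
  have h0' : (((p : ℝ) ^ (-v) : ℝ) : ℂ) ≠ 0 := Complex.ofReal_ne_zero.mpr h0.ne'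
  have h1 : (((p : ℝ) ^ (-v) : ℝ) : ℂ) ^ s = (p : ℂ) ^ (-(v : ℂ) * s) := by
    rw [Complex.cpow_def_of_ne_zero h0', Complex.cpow_def_of_ne_zero hp',
      ← Complex.ofReal_log h0.le, Real.log_zpow, ← Complex.natCast_log]
    push_cast
    ring_nf
  rw [Complex.cpow_sub _ _ h0', h1, Complex.cpow_one]
  push_cast
  rw [zpow_neg, div_inv_eq_mul, mul_comm]

/-- A function of `s` that, on the right half plane, is a Laurent polynomial in `p ^ (-s)`. -/
def IsLaurentInCpow (p : ℕ) (F : ℂ → ℂ) : Prop :=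
  ∃ (M : ℕ) (P : Polynomial ℂ), ∀ s : ℂ, 0 < s.re →
    F s = (p : ℂ) ^ ((M : ℂ) * s) * P.eval ((p : ℂ) ^ (-s))

namespace IsLaurentInCpow

variable {p : ℕ} {F G : ℂ → ℂ}

lemma congr (hF : IsLaurentInCpow p F) (h : ∀ s : ℂ, 0 < s.re → G s = F s) :
    IsLaurentInCpow p G := by
  obtain ⟨M, P, hP⟩ := hF
  exact ⟨M, P, fun s hs => (h s hs).trans (hP s hs)⟩

lemma const (c : ℂ) : IsLaurentInCpow p fun _ => c :=
  ⟨0, Polynomial.C c, fun s _ => by simp⟩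

lemma cpow_neg_pow (n : ℕ) : IsLaurentInCpow p fun s => ((p : ℂ) ^ (-s)) ^ n :=
  ⟨0, Polynomial.X ^ n, fun s _ => by simp⟩

lemma cpow_natCast_mul (n : ℕ) : IsLaurentInCpow p fun s => (p : ℂ) ^ ((n : ℂ) * s) :=
  ⟨n, 1, fun s _ => by simp⟩

lemma mul (hp : p ≠ 0) (hF : IsLaurentInCpow p F) (hG : IsLaurentInCpow p G) :
    IsLaurentInCpow p fun s => F s * G s := by
  obtain ⟨M, P, hP⟩ := hF
  obtain ⟨N, Q, hQ⟩ := hG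
  refine ⟨M + N, P * Q, fun s hs => ?_⟩
  have hp' : (p : ℂ) ≠ 0 := Nat.cast_ne_zero.mpr hp
  simp only [hP s hs, hQ s hs, Polynomial.eval_mul]
  push_cast
  rw [add_mul, Complex.cpow_add _ _ hp']
  ring

lemma add (hp : p ≠ 0) (hF : IsLaurentInCpow p F) (hG : IsLaurentInCpow p G) :
    IsLaurentInCpow p fun s => F s + G s := by
  obtain ⟨M, P, hP⟩ := hF
  obtain ⟨N, Q, hQ⟩ := hG
  refine ⟨M + N, Polynomial.X ^ N * P + Polynomial.X ^ M * Q, fun s hs => ?_⟩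
  have hp' : (p : ℂ) ≠ 0 := Nat.cast_ne_zero.mpr hp
  have key (n : ℕ) : (p : ℂ) ^ ((n : ℂ) * s) * ((p : ℂ) ^ (-s)) ^ n = 1 := by
    rw [← Complex.cpow_nat_mul, ← Complex.cpow_add _ _ hp']
    simp
  simp only [hP s hs, hQ s hs, Polynomial.eval_mul, Polynomial.eval_add, Polynomial.eval_pow,
    Polynomial.eval_X]
  push_cast
  rw [add_mul, Complex.cpow_add _ _ hp']
  linear_combination (-(p : ℂ) ^ ((M : ℂ) * s) * P.eval ((p : ℂ) ^ (-s))) * key N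
    - ((p : ℂ) ^ ((N : ℂ) * s) * Q.eval ((p : ℂ) ^ (-s))) * key M

lemma sum (hp : p ≠ 0) {ι : Type*} (t : Finset ι) {F : ι → ℂ → ℂ}
    (hF : ∀ i ∈ t, IsLaurentInCpow p (F i)) : IsLaurentInCpow p fun s => ∑ i ∈ t, F i s := by
  induction t using Finset.induction_on with
  | empty => simpa using const 0
  | insert i t hi ih =>
    refine ((hF i (Finset.mem_insert_self i t)).add hp
      (ih fun j hj => hF j (Finset.mem_insert_of_mem hj))).congr fun s _ => ?_
    rw [Finset.sum_insert hi]

lemma zpow_cpow_sub_one (hp : p ≠ 0) (v : ℤ) :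
    IsLaurentInCpow p fun s => (((p : ℝ) ^ (-v) : ℝ) : ℂ) ^ (s - 1) := by
  refine IsLaurentInCpow.congr (F := fun s => (p : ℂ) ^ v * (p : ℂ) ^ (-(v : ℂ) * s)) ?_
    fun s _ => ofReal_zpow_neg_cpow_sub_one hp v s
  refine (const _).mul hp ?_
  obtain ⟨n, rfl | rfl⟩ := v.eq_nat_or_neg
  · refine (cpow_neg_pow n).congr fun s _ => ?_
    rw [← Complex.cpow_nat_mul]
    push_cast
    ring_nf
  · refine (cpow_natCast_mul n).congr fun s _ => ?_
    push_cast
    ring_nf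

end IsLaurentInCpow

namespace Padic

open Metric

variable {p : ℕ} [Fact p.Prime]

lemma closedBall_zero_zpow_eq_iUnion (n : ℤ) :
    closedBall (0 : ℚ_[p]) ((p : ℝ) ^ (-n)) =
      ⋃ k : Fin p, closedBall ((k : ℚ_[p]) * (p : ℚ_[p]) ^ n) ((p : ℝ) ^ (-(n + 1))) := by
  have hp : (p : ℚ_[p]) ≠ 0 := Nat.cast_ne_zero.mpr (Fact.out : p.Prime).ne_zero
  have hp0 : (0 : ℝ) < p := Nat.cast_pos.mpr (Fact.out : p.Prime).pos
  have hp1 : (1 : ℝ) < p := Nat.one_lt_cast.mpr (Fact.out : p.Prime).one_lt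
  ext x
  simp only [mem_closedBall, dist_eq_norm, sub_zero, Set.mem_iUnion]
  constructor
  · intro hx
    have hy : ‖x * (p : ℚ_[p]) ^ (-n)‖ ≤ 1 := by
      rw [norm_mul, norm_p_zpow, neg_neg]
      calc ‖x‖ * (p : ℝ) ^ n ≤ (p : ℝ) ^ (-n) * (p : ℝ) ^ n := by gcongr
        _ = 1 := by rw [← zpow_add₀ hp0.ne']; simp
    obtain ⟨k, hk, hmem⟩ := PadicInt.exists_mem_range (⟨_, hy⟩ : ℤ_[p])
    refine ⟨⟨k, hk⟩, ?_⟩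
    rw [IsLocalRing.mem_maximalIdeal, PadicInt.mem_nonunits, PadicInt.norm_def] at hmem
    have hle : ‖x * (p : ℚ_[p]) ^ (-n) - k‖ ≤ (p : ℝ) ^ (-1 : ℤ) := by
      rw [norm_le_pow_iff_norm_lt_pow_add_one]
      rw [neg_add_cancel, zpow_zero]
      exact hmem
    have hfac : x - (k : ℚ_[p]) * (p : ℚ_[p]) ^ n =
        (x * (p : ℚ_[p]) ^ (-n) - k) * (p : ℚ_[p]) ^ n := by
      rw [sub_mul, mul_assoc, ← zpow_add₀ hp]
      simp
    rw [hfac, norm_mul, norm_p_zpow, neg_add_rev, zpow_add₀ hp0.ne']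
    gcongr
  · rintro ⟨k, hk⟩
    have h1 : ‖(k : ℚ_[p]) * (p : ℚ_[p]) ^ n‖ ≤ (p : ℝ) ^ (-n) := by
      rw [norm_mul, norm_p_zpow]
      exact mul_le_of_le_one_left (by positivity) (by simpa using norm_int_le_one (p := p) (k : ℤ))
    have h2 : (p : ℝ) ^ (-(n + 1)) ≤ (p : ℝ) ^ (-n) := zpow_le_zpow_right₀ hp1.le (by omega)
    calc ‖x‖ = ‖(x - (k : ℚ_[p]) * (p : ℚ_[p]) ^ n) + (k : ℚ_[p]) * (p : ℚ_[p]) ^ n‖ := by simp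
      _ ≤ _ := (nonarchimedean _ _).trans (max_le (hk.trans h2) h1)

lemma pairwise_disjoint_closedBall_natCast_mul_zpow (n : ℤ) :
    Pairwise (Function.onFun Disjoint fun k : Fin p =>
      closedBall ((k : ℚ_[p]) * (p : ℚ_[p]) ^ n) ((p : ℝ) ^ (-(n + 1)))) := by
  have hp0 : (0 : ℝ) < p := Nat.cast_pos.mpr (Fact.out : p.Prime).pos
  intro j k hjk
  refine (IsUltrametricDist.closedBall_eq_or_disjoint _ _ _).resolve_left fun h => hjk ?_
  have hmem : (j : ℚ_[p]) * (p : ℚ_[p]) ^ n ∈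
      closedBall ((k : ℚ_[p]) * (p : ℚ_[p]) ^ n) ((p : ℝ) ^ (-(n + 1))) :=
    h ▸ mem_closedBall_self (by positivity)
  rw [mem_closedBall, dist_eq_norm, ← sub_mul, norm_mul, norm_p_zpow, neg_add_rev,
    zpow_add₀ hp0.ne'] at hmem
  have hle := le_of_mul_le_mul_right hmem (by positivity)
  rw [norm_le_pow_iff_norm_lt_pow_add_one] at hle
  have hdvd : (p : ℤ) ∣ (j : ℤ) - (k : ℤ) := by
    rw [← norm_intCast_lt_one_iff]
    simpa using hle
  have hj := j.isLt
  have hk := k.isLt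
  have := Int.eq_zero_of_abs_lt_dvd hdvd (by rw [abs_lt]; omega)
  exact Fin.ext (by omega)

/-- The function `x ↦ ‖x‖ ^ (s - 1)`, extended by `0` at the origin. -/
noncomputable def normCpow (s : ℂ) (x : ℚ_[p]) : ℂ :=
  if x = 0 then 0 else ((‖x‖ : ℝ) : ℂ) ^ (s - 1)

lemma normCpow_zero (s : ℂ) : normCpow s (0 : ℚ_[p]) = 0 := if_pos rfl

lemma normCpow_of_ne {x : ℚ_[p]} (hx : x ≠ 0) (s : ℂ) :
    normCpow s x = ((‖x‖ : ℝ) : ℂ) ^ (s - 1) := if_neg hx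

lemma normCpow_mul (s : ℂ) (x y : ℚ_[p]) : normCpow s (x * y) = normCpow s x * normCpow s y := by
  by_cases hx : x = 0
  · simp [hx, normCpow_zero]
  by_cases hy : y = 0
  · simp [hy, normCpow_zero]
  rw [normCpow_of_ne hx, normCpow_of_ne hy, normCpow_of_ne (mul_ne_zero hx hy), norm_mul,
    Complex.ofReal_mul, Complex.mul_cpow_ofReal_nonneg (norm_nonneg _) (norm_nonneg _)]

lemma norm_eq_of_mem_closedBall {a x : ℚ_[p]} {r : ℝ} (ha : r < ‖a‖) (hx : x ∈ closedBall a r) :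
    ‖x‖ = ‖a‖ := by
  rw [mem_closedBall, dist_eq_norm] at hx
  exact norm_eq_of_norm_sub_lt_right (hx.trans_lt ha)

lemma sphere_zero_eq_diff (n : ℤ) :
    sphere (0 : ℚ_[p]) ((p : ℝ) ^ (-n)) =
      closedBall 0 ((p : ℝ) ^ (-n)) \ closedBall 0 ((p : ℝ) ^ (-(n + 1))) := by
  ext x
  have h := norm_le_pow_iff_norm_lt_pow_add_one x (-(n + 1))
  rw [show -(n + 1) + 1 = -n by ring] at h
  simp only [mem_sphere_iff_norm, sub_zero, Set.mem_sdiff, mem_closedBall, dist_zero_right, h,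
    not_lt]
  exact le_antisymm_iff

lemma normCpow_eqOn_sphere (s : ℂ) (n : ℤ) :
    Set.EqOn (normCpow s) (fun _ => (((p : ℝ) ^ (-n) : ℝ) : ℂ) ^ (s - 1))
      (sphere (0 : ℚ_[p]) ((p : ℝ) ^ (-n))) := by
  have hp0 : (0 : ℝ) < p := Nat.cast_pos.mpr (Fact.out : p.Prime).pos
  intro x hx
  have hx' : ‖x‖ = (p : ℝ) ^ (-n) := by simpa using hx
  have h0 : x ≠ 0 := by
    rw [← norm_pos_iff, hx']
    positivity
  simp only [normCpow_of_ne h0, hx']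

variable [MeasurableSpace ℚ_[p]] [BorelSpace ℚ_[p]]

lemma setIntegral_norm_normCpow_sphere (μ : Measure ℚ_[p]) (s : ℂ) (n : ℤ) :
    ∫ x in sphere (0 : ℚ_[p]) ((p : ℝ) ^ (-n)), ‖normCpow s x‖ ∂μ =
      ‖∫ x in sphere (0 : ℚ_[p]) ((p : ℝ) ^ (-n)), normCpow s x ∂μ‖ := by
  rw [setIntegral_congr_fun isClosed_sphere.measurableSet (normCpow_eqOn_sphere s n),
    setIntegral_congr_fun isClosed_sphere.measurableSet fun x hx =>
      congrArg norm (normCpow_eqOn_sphere s n hx)]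
  simp [abs_of_nonneg measureReal_nonneg]

variable (μ : Measure ℚ_[p]) [μ.IsAddHaarMeasure]

lemma measureReal_closedBall (a : ℚ_[p]) (r : ℝ) :
    μ.real (closedBall a r) = μ.real (closedBall 0 r) := by
  have h : (fun x => -a + x) ⁻¹' closedBall 0 r = closedBall a r := by
    ext x
    simp [dist_eq_norm, neg_add_eq_sub]
  rw [← h, measureReal_def, measure_preimage_add, ← measureReal_def]

lemma measureReal_closedBall_zpow_succ (n : ℤ) :
    μ.real (closedBall (0 : ℚ_[p]) ((p : ℝ) ^ (-n))) =
      p * μ.real (closedBall (0 : ℚ_[p]) ((p : ℝ) ^ (-(n + 1)))) := by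
  rw [closedBall_zero_zpow_eq_iUnion, measureReal_iUnion_fintype
    (pairwise_disjoint_closedBall_natCast_mul_zpow n) (fun _ => measurableSet_closedBall)
    fun _ => (isCompact_closedBall _ _).measure_lt_top.ne]
  simp_rw [measureReal_closedBall μ ((_ : ℚ_[p]) * _)]
  simp

variable {μ}

lemma measureReal_closedBall_pow (hμ : μ {x : ℚ_[p] | ‖x‖ ≤ 1} = 1) (n : ℕ) :
    μ.real (closedBall (0 : ℚ_[p]) ((p : ℝ) ^ (-n : ℤ))) = ((p : ℝ)⁻¹) ^ n := by
  have hp0 : (p : ℝ) ≠ 0 := Nat.cast_ne_zero.mpr (Fact.out : p.Prime).ne_zero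
  induction n with
  | zero =>
    have h : closedBall (0 : ℚ_[p]) 1 = {x | ‖x‖ ≤ 1} := by
      ext x
      simp
    simp [h, measureReal_def, hμ]
  | succ n ih =>
    rw [measureReal_closedBall_zpow_succ] at ih
    push_cast
    rw [pow_succ, ← ih]
    field_simp

lemma measureReal_sphere_pow (hμ : μ {x : ℚ_[p] | ‖x‖ ≤ 1} = 1) (n : ℕ) :
    μ.real (sphere (0 : ℚ_[p]) ((p : ℝ) ^ (-n : ℤ))) = ((p : ℝ)⁻¹) ^ n * (1 - (p : ℝ)⁻¹) := by
  have hp1 : (1 : ℝ) < p := Nat.one_lt_cast.mpr (Fact.out : p.Prime).one_lt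
  rw [sphere_zero_eq_diff, measureReal_sdiff (closedBall_subset_closedBall
    (zpow_le_zpow_right₀ hp1.le (by omega))) measurableSet_closedBall
    (isCompact_closedBall _ _).measure_lt_top.ne]
  have h := measureReal_closedBall_pow hμ (n + 1)
  push_cast at h
  rw [measureReal_closedBall_pow hμ n, h]
  ring

lemma integrableOn_normCpow_sphere (s : ℂ) (n : ℤ) :
    IntegrableOn (normCpow s) (sphere (0 : ℚ_[p]) ((p : ℝ) ^ (-n))) μ :=
  (integrableOn_const (isCompact_sphere _ _).measure_lt_top.ne).congr_fun
    (normCpow_eqOn_sphere s n).symm isClosed_sphere.measurableSet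

lemma setIntegral_normCpow_sphere (hμ : μ {x : ℚ_[p] | ‖x‖ ≤ 1} = 1) (s : ℂ) (n : ℕ) :
    ∫ x in sphere (0 : ℚ_[p]) ((p : ℝ) ^ (-n : ℤ)), normCpow s x ∂μ =
      (1 - (p : ℂ)⁻¹) * ((p : ℂ) ^ (-s)) ^ n := by
  have hp : p ≠ 0 := (Fact.out : p.Prime).ne_zero
  have hp' : (p : ℂ) ≠ 0 := Nat.cast_ne_zero.mpr hp
  rw [setIntegral_congr_fun isClosed_sphere.measurableSet (normCpow_eqOn_sphere s n),
    setIntegral_const, measureReal_sphere_pow hμ, ofReal_zpow_neg_cpow_sub_one hp, ← Complex.cpow_nat_mul,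
    Complex.real_smul, Int.cast_natCast, neg_mul, mul_neg]
  push_cast
  rw [zpow_natCast, inv_pow]
  field_simp

lemma integral_normCpow_closedBall_zero (hμ : μ {x : ℚ_[p] | ‖x‖ ≤ 1} = 1) (N : ℕ) {s : ℂ}
    (hs : 0 < s.re) :
    IntegrableOn (normCpow s) (closedBall (0 : ℚ_[p]) ((p : ℝ) ^ (-N : ℤ))) μ ∧
      (1 - (p : ℂ) ^ (-s)) * ∫ x in closedBall (0 : ℚ_[p]) ((p : ℝ) ^ (-N : ℤ)), normCpow s x ∂μ =
        (1 - (p : ℂ)⁻¹) * ((p : ℂ) ^ (-s)) ^ N := by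
  have hp0 : (0 : ℝ) < p := Nat.cast_pos.mpr (Fact.out : p.Prime).pos
  have hp1 : (1 : ℝ) < p := Nat.one_lt_cast.mpr (Fact.out : p.Prime).one_lt
  have hz : ‖(p : ℂ) ^ (-s)‖ < 1 := by
    rw [Complex.norm_natCast_cpow_of_pos (Fact.out : p.Prime).pos]
    exact Real.rpow_lt_one_of_one_lt_of_neg hp1 (by simpa using hs)
  have hz1 : 1 - (p : ℂ) ^ (-s) ≠ 0 := by
    intro h
    rw [← sub_eq_zero.mp h] at hz
    simp at hz
  let S : ℕ → Set ℚ_[p] := fun j => sphere 0 ((p : ℝ) ^ (-(N + j : ℕ) : ℤ))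
  have hSm (j : ℕ) : MeasurableSet (S j) := isClosed_sphere.measurableSet
  have hSd : Pairwise (Function.onFun Disjoint S) := by
    intro i j hij
    refine Set.disjoint_left.mpr fun x hi hj => hij ?_
    have h := (mem_sphere.mp hi).symm.trans (mem_sphere.mp hj)
    have := zpow_right_injective₀ hp0 hp1.ne' h
    omega
  have hSsub : (⋃ j, S j) ⊆ closedBall (0 : ℚ_[p]) ((p : ℝ) ^ (-N : ℤ)) := by
    refine Set.iUnion_subset fun j => sphere_subset_closedBall.trans
      (closedBall_subset_closedBall (zpow_le_zpow_right₀ hp1.le ?_))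
    omega
  have hvan : ∀ x ∈ closedBall (0 : ℚ_[p]) ((p : ℝ) ^ (-N : ℤ)) \ ⋃ j, S j,
      normCpow s x = 0 := by
    rintro x ⟨hx, hxS⟩
    by_contra hne
    have hx0 : x ≠ 0 := fun h => hne (h ▸ normCpow_zero s)
    have hnx := norm_eq_zpow_neg_valuation hx0
    rw [mem_closedBall, dist_zero_right, hnx, zpow_le_zpow_iff_right₀ hp1] at hx
    refine hxS (Set.mem_iUnion.mpr ⟨(x.valuation - N).toNat, ?_⟩)
    rw [mem_sphere, dist_zero_right, hnx]
    congr 1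
    omega
  have hSint (j : ℕ) : ∫ x in S j, normCpow s x ∂μ =
      (1 - (p : ℂ)⁻¹) * ((p : ℂ) ^ (-s)) ^ N * ((p : ℂ) ^ (-s)) ^ j := by
    rw [setIntegral_normCpow_sphere hμ, pow_add, mul_assoc]
  have hgeom := (hasSum_geometric_of_norm_lt_one hz).mul_left
    ((1 - (p : ℂ)⁻¹) * ((p : ℂ) ^ (-s)) ^ N)
  have hintegrand : IntegrableOn (normCpow s) (⋃ j, S j) μ := by
    refine integrableOn_iUnion_of_summable_integral_norm
      (fun j => integrableOn_normCpow_sphere s _) ?_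
    refine hgeom.summable.norm.congr fun j => ?_
    rw [← hSint]
    exact (setIntegral_norm_normCpow_sphere μ s _).symm
  refine ⟨hintegrand.of_forall_sdiff_eq_zero measurableSet_closedBall hvan, ?_⟩
  have hsum := hasSum_integral_iUnion hSm hSd hintegrand
  simp_rw [hSint] at hsum
  rw [setIntegral_eq_of_subset_of_forall_sdiff_eq_zero measurableSet_closedBall hSsub hvan,
    hsum.unique hgeom]
  field_simp

lemma isLaurentInCpow_integral_normCpow_closedBall (hμ : μ {x : ℚ_[p] | ‖x‖ ≤ 1} = 1)
    (a : ℚ_[p]) (N : ℕ) :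
    (∀ s : ℂ, 0 < s.re → IntegrableOn (normCpow s) (closedBall a ((p : ℝ) ^ (-N : ℤ))) μ) ∧
      IsLaurentInCpow p fun s =>
        (1 - (p : ℂ) ^ (-s)) * ∫ x in closedBall a ((p : ℝ) ^ (-N : ℤ)), normCpow s x ∂μ := by
  have hp : p ≠ 0 := (Fact.out : p.Prime).ne_zero
  have hp0 : (0 : ℝ) < p := Nat.cast_pos.mpr (Fact.out : p.Prime).pos
  by_cases ha : ‖a‖ ≤ (p : ℝ) ^ (-N : ℤ)
  · rw [IsUltrametricDist.closedBall_eq_of_mem (y := 0) (by simpa using ha)]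
    refine ⟨fun s hs => (integral_normCpow_closedBall_zero hμ N hs).1,
      (((IsLaurentInCpow.const (1 - (p : ℂ)⁻¹)).mul hp (.cpow_neg_pow N)).congr
        fun s hs => (integral_normCpow_closedBall_zero hμ N hs).2)⟩
  · have ha0 : a ≠ 0 := by
      rintro rfl
      exact ha (by rw [norm_zero]; positivity)
    have heq (s : ℂ) : Set.EqOn (normCpow s)
        (fun _ => (((p : ℝ) ^ (-a.valuation) : ℝ) : ℂ) ^ (s - 1))
        (closedBall a ((p : ℝ) ^ (-N : ℤ))) := by
      intro x hx
      have hx' := norm_eq_of_mem_closedBall (not_le.mp ha) hx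
      have hx0 : x ≠ 0 := by
        rw [← norm_ne_zero_iff, hx']
        exact norm_ne_zero_iff.mpr ha0
      simp only [normCpow_of_ne hx0, hx', norm_eq_zpow_neg_valuation ha0]
    refine ⟨fun s _ => (integrableOn_const (isCompact_closedBall _ _).measure_lt_top.ne).congr_fun
      (heq s).symm measurableSet_closedBall, ?_⟩
    have hone : IsLaurentInCpow p fun s => 1 - (p : ℂ) ^ (-s) :=
      (((IsLaurentInCpow.const 1).add hp ((IsLaurentInCpow.const (-1)).mul hp
        (.cpow_neg_pow 1)))).congr fun s _ => by ring
    refine ((hone.mul hp ((IsLaurentInCpow.const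
      (μ.real (closedBall a ((p : ℝ) ^ (-N : ℤ))) : ℂ)).mul hp
        (.zpow_cpow_sub_one hp a.valuation)))).congr fun s _ => ?_
    rw [setIntegral_congr_fun measurableSet_closedBall (heq s), setIntegral_const,
      Complex.real_smul]

end Padic

lemma IsUltrametricDist.prod (X Y : Type*) [PseudoMetricSpace X] [PseudoMetricSpace Y]
    [IsUltrametricDist X] [IsUltrametricDist Y] : IsUltrametricDist (X × Y) where
  dist_triangle_max x y z := by
    simp only [Prod.dist_eq]
    exact (max_le_max (dist_triangle_max x.1 y.1 z.1) (dist_triangle_max x.2 y.2 z.2)).trans_eq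
      (max_max_max_comm _ _ _ _)

/-- A locally constant function with compact support on an ultrametric space is supported on
finitely many disjoint closed balls of a common radius, on each of which it is constant. -/
lemma IsLocallyConstant.exists_finset_closedBall {X Y : Type*} [PseudoMetricSpace X]
    [IsUltrametricDist X] [Zero Y] {f : X → Y} (hf : IsLocallyConstant f)
    (hfc : HasCompactSupport f) {r : ℕ → ℝ} (hr : ∀ n, 0 < r n)
    (hr0 : Filter.Tendsto r Filter.atTop (nhds 0)) :
    ∃ (n : ℕ) (T : Finset (Set X)),
      (∀ B ∈ T, ∃ a, B = Metric.closedBall a (r n) ∧ ∀ x ∈ B, f x = f a) ∧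
      (T : Set (Set X)).PairwiseDisjoint id ∧ Function.support f ⊆ ⋃ B ∈ T, B := by
  obtain ⟨δ, hδ, hball⟩ := lebesgue_number_lemma_of_metric (c := fun y : Y => f ⁻¹' {y}) hfc
    (fun y => hf.isOpen_fiber y) fun x _ => Set.mem_iUnion.mpr ⟨f x, rfl⟩
  obtain ⟨n, hn⟩ := (hr0.eventually_lt_const hδ).exists
  obtain ⟨t, htK, htfin, hcov⟩ := hfc.finite_cover_balls (hr n)
  refine ⟨n, htfin.toFinset.image fun a => Metric.closedBall a (r n), ?_, ?_, ?_⟩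
  · intro B hB
    obtain ⟨a, ha, rfl⟩ := Finset.mem_image.mp hB
    refine ⟨a, rfl, fun x hx => ?_⟩
    obtain ⟨y, hy⟩ := hball a (htK (htfin.mem_toFinset.mp ha))
    have hxy : f x = y := hy (Metric.closedBall_subset_ball hn hx)
    have hay : f a = y := hy (Metric.mem_ball_self hδ)
    rw [hxy, hay]
  · intro B hB C hC hBC
    obtain ⟨a, -, rfl⟩ := Finset.mem_image.mp hB
    obtain ⟨b, -, rfl⟩ := Finset.mem_image.mp hC
    exact (IsUltrametricDist.closedBall_eq_or_disjoint a b (r n)).resolve_left hBC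
  · intro x hx
    obtain ⟨a, ha, hxa⟩ := Set.mem_iUnion₂.mp (hcov (subset_tsupport f hx))
    exact Set.mem_iUnion₂.mpr ⟨_, Finset.mem_image_of_mem _ (htfin.mem_toFinset.mpr ha),
      Metric.ball_subset_closedBall hxa⟩

/-- Non-Archimedean split Mellin transform: for a Schwartz–Bruhat function `Φ` on `ℚ_p²`, the
zeta integral `Z(s) = ∫ Φ(x,y)·‖xy‖^{s−1}` converges for `Re s > 0` and is a rational function of
`p^{−s}` whose denominator divides `(1 − p^{−s})²`. -/
theorem stmt_13 (p : ℕ) [Fact p.Prime]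
    [MeasurableSpace ℚ_[p]] [BorelSpace ℚ_[p]]
    (μ : Measure ℚ_[p]) [μ.IsAddHaarMeasure]
    (hμ : μ {x : ℚ_[p] | ‖x‖ ≤ 1} = 1)
    (Φ : ℚ_[p] × ℚ_[p] → ℂ) (hΦ : IsLocallyConstant Φ) (hΦc : HasCompactSupport Φ) :
    (∀ s : ℂ, 0 < s.re →
      Integrable (fun q : ℚ_[p] × ℚ_[p] =>
        if q.1 * q.2 = 0 then 0 else Φ q * ((‖q.1 * q.2‖ : ℝ) : ℂ) ^ (s - 1)) (μ.prod μ)) ∧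
    ∃ (M : ℕ) (P : Polynomial ℂ), ∀ s : ℂ, 0 < s.re →
      (1 - (p : ℂ) ^ (-s)) ^ 2 *
          ∫ q : ℚ_[p] × ℚ_[p],
            (if q.1 * q.2 = 0 then 0 else Φ q * ((‖q.1 * q.2‖ : ℝ) : ℂ) ^ (s - 1)) ∂(μ.prod μ) =
        (p : ℂ) ^ ((M : ℂ) * s) * P.eval ((p : ℂ) ^ (-s)) := by
  have hp : p ≠ 0 := (Fact.out : p.Prime).ne_zero
  have hp0 : (0 : ℝ) < p := Nat.cast_pos.mpr (Fact.out : p.Prime).pos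
  have hp1 : (1 : ℝ) < p := Nat.one_lt_cast.mpr (Fact.out : p.Prime).one_lt
  have hintegrand (s : ℂ) : (fun q : ℚ_[p] × ℚ_[p] =>
      if q.1 * q.2 = 0 then 0 else Φ q * ((‖q.1 * q.2‖ : ℝ) : ℂ) ^ (s - 1)) =
      fun q => Φ q * (Padic.normCpow s q.1 * Padic.normCpow s q.2) := by
    funext q
    rw [← Padic.normCpow_mul, Padic.normCpow, mul_ite, mul_zero]
  simp_rw [hintegrand]
  have := IsUltrametricDist.prod ℚ_[p] ℚ_[p]
  obtain ⟨N, T, hT, hTd, hsupp⟩ := hΦ.exists_finset_closedBall hΦc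
    (r := fun n : ℕ => (p : ℝ) ^ (-n : ℤ)) (fun n => by positivity) (by
      simpa [← inv_pow] using
        tendsto_pow_atTop_nhds_zero_of_lt_one (inv_nonneg.mpr hp0.le) (inv_lt_one_of_one_lt₀ hp1))
  have hTm : ∀ B ∈ T, MeasurableSet B := by
    intro B hB
    obtain ⟨a, rfl, -⟩ := hT B hB
    exact Metric.isClosed_closedBall.measurableSet
  have hpiece : ∀ B ∈ T,
      (∀ s : ℂ, 0 < s.re → IntegrableOn
        (fun q => Φ q * (Padic.normCpow s q.1 * Padic.normCpow s q.2)) B (μ.prod μ)) ∧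
      IsLaurentInCpow p fun s => (1 - (p : ℂ) ^ (-s)) ^ 2 *
        ∫ q in B, Φ q * (Padic.normCpow s q.1 * Padic.normCpow s q.2) ∂(μ.prod μ) := by
    intro B hB
    have hBm := hTm B hB
    obtain ⟨⟨a, b⟩, rfl, hconst⟩ := hT B hB
    have heq (s : ℂ) : Set.EqOn
        (fun q => Φ q * (Padic.normCpow s q.1 * Padic.normCpow s q.2))
        (fun q => Φ (a, b) * (Padic.normCpow s q.1 * Padic.normCpow s q.2))
        (Metric.closedBall (a, b) ((p : ℝ) ^ (-N : ℤ))) := fun q hq => by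
      simp only [hconst q hq]
    obtain ⟨ha, hLa⟩ := Padic.isLaurentInCpow_integral_normCpow_closedBall hμ a N
    obtain ⟨hb, hLb⟩ := Padic.isLaurentInCpow_integral_normCpow_closedBall hμ b N
    constructor
    · intro s hs
      refine IntegrableOn.congr_fun ?_ (heq s).symm hBm
      rw [← closedBall_prod_same, IntegrableOn, ← Measure.prod_restrict]
      exact ((ha s hs).mul_prod (hb s hs)).const_mul _
    · refine ((IsLaurentInCpow.const (Φ (a, b))).mul hp (hLa.mul hp hLb)).congr fun s _ => ?_
      rw [setIntegral_congr_fun hBm (heq s), integral_const_mul, ← closedBall_prod_same,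
        setIntegral_prod_mul]
      ring
  have hsupp' (s : ℂ) : Function.support
      (fun q => Φ q * (Padic.normCpow s q.1 * Padic.normCpow s q.2)) ⊆ ⋃ B ∈ T, B :=
    (Function.support_mul_subset_left _ _).trans hsupp
  constructor
  · intro s hs
    rw [← integrableOn_iff_integrable_of_support_subset (hsupp' s), integrableOn_finset_iUnion]
    exact fun B hB => (hpiece B hB).1 s hs
  · refine (IsLaurentInCpow.sum hp T fun B hB => (hpiece B hB).2).congr fun s hs => ?_
    rw [← Finset.mul_sum, ← integral_biUnion_finset T hTm hTd fun B hB => (hpiece B hB).1 s hs,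
      setIntegral_eq_integral_of_forall_compl_eq_zero fun q hq =>
        Function.notMem_support.mp fun h => hq (hsupp' s h)]
end

section
/- For every natural number n and every real number t > 2, ∫_{−2}^{2} T_n(v/2) / ((t − v)·√(4 − v²)) dv = π · ((t − √(t² − 4))/2)^n / √(t² − 4), where T_n denotes the n-th Chebyshev polynomial of the first kind. -/
open Filter Topology in
/-- A bounded solution of `K (n + 2) + K n = (q + q⁻¹) K (n + 1)` with `0 < q < 1` is geometric. -/
theorem eq_pow_mul_of_bounded_of_recurrence {K : ℕ → ℝ} {q t C : ℝ} (hq0 : 0 < q) (hq1 : q < 1)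
    (hqt : t * q = q ^ 2 + 1) (hC : ∀ n, |K n| ≤ C)
    (hK : ∀ n, K (n + 2) + K n = t * K (n + 1)) (n : ℕ) : K n = q ^ n * K 0 := by
  have hgeom : ∀ n, K 1 - q * K 0 = q ^ n * (K (n + 1) - q * K n) := by
    intro n
    induction n with
    | zero => simp
    | succ k ih =>
      rw [ih, pow_succ]
      linear_combination (-q ^ k * q) * hK k - q ^ k * K (k + 1) * hqt
  have hzero : K 1 - q * K 0 = 0 := by
    have hlim : Tendsto (fun n => q ^ n * (C + q * C)) atTop (𝓝 0) := by
      simpa using (tendsto_pow_atTop_nhds_zero_of_lt_one hq0.le hq1).mul_const (C + q * C)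
    have hle : |K 1 - q * K 0| ≤ 0 := by
      refine ge_of_tendsto' hlim fun n => ?_
      rw [hgeom n, abs_mul, abs_of_pos (pow_pos hq0 n)]
      gcongr
      calc |K (n + 1) - q * K n| ≤ |K (n + 1)| + |q * K n| := abs_sub _ _
        _ ≤ C + q * C := by
          rw [abs_mul, abs_of_pos hq0]
          gcongr
          exacts [hC _, hC _]
    exact abs_nonpos_iff.mp hle
  induction n with
  | zero => simp
  | succ k ih =>
    have h := hgeom k
    rw [hzero] at h
    have h' := (mul_eq_zero.mp h.symm).resolve_left (pow_pos hq0 k).ne'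
    rw [pow_succ]
    linear_combination h' + q * ih

theorem integral_cos_nat_mul_zero_pi {n : ℕ} (hn : n ≠ 0) :
    ∫ θ in (0 : ℝ)..Real.pi, Real.cos (n * θ) = 0 := by
  rw [intervalIntegral.integral_comp_mul_left _ (Nat.cast_ne_zero.mpr hn)]
  simp [Real.sin_nat_mul_pi]

theorem continuous_cos_nat_mul_div {t : ℝ} (ht : 2 < t) (n : ℕ) :
    Continuous fun θ : ℝ => Real.cos (n * θ) / (t - 2 * Real.cos θ) :=
  Continuous.div (by fun_prop) (by fun_prop) fun θ => by linarith [Real.cos_le_one θ]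

theorem abs_integral_cos_nat_mul_div_le {t : ℝ} (ht : 2 < t) (n : ℕ) :
    |∫ θ in (0 : ℝ)..Real.pi, Real.cos (n * θ) / (t - 2 * Real.cos θ)| ≤
      1 / (t - 2) * Real.pi := by
  have h := intervalIntegral.norm_integral_le_of_norm_le_const (a := 0) (b := Real.pi)
    (f := fun θ => Real.cos (n * θ) / (t - 2 * Real.cos θ)) (C := 1 / (t - 2)) fun θ _ => by
      have hθ := Real.cos_le_one θ
      rw [Real.norm_eq_abs, abs_div, abs_of_pos (show 0 < t - 2 * Real.cos θ by linarith)]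
      exact div_le_div₀ zero_le_one (Real.abs_cos_le_one _) (by linarith) (by linarith)
  simpa [abs_of_pos Real.pi_pos] using h

theorem integral_cos_div_eq {t : ℝ} (ht : 2 < t) :
    2 * ∫ θ in (0 : ℝ)..Real.pi, Real.cos ((1 : ℕ) * θ) / (t - 2 * Real.cos θ) =
      t * (∫ θ in (0 : ℝ)..Real.pi, Real.cos ((0 : ℕ) * θ) / (t - 2 * Real.cos θ)) -
        Real.pi := by
  have hint : (∫ _ in (0 : ℝ)..Real.pi, (1 : ℝ)) = Real.pi := by simp
  refine Eq.trans ?_ (congrArg (t * _ - ·) hint)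
  rw [← intervalIntegral.integral_const_mul, ← intervalIntegral.integral_const_mul,
    ← intervalIntegral.integral_sub
      (((continuous_cos_nat_mul_div ht _).const_mul t).intervalIntegrable _ _)
      (continuous_const.intervalIntegrable _ _)]
  refine intervalIntegral.integral_congr fun θ _ => ?_
  have hθ : t - 2 * Real.cos θ ≠ 0 := by linarith [Real.cos_le_one θ]
  simp only [Nat.cast_one, one_mul, Nat.cast_zero, zero_mul, Real.cos_zero]
  field_simp
  ring

theorem integral_cos_nat_mul_div_recurrence {t : ℝ} (ht : 2 < t) (n : ℕ) :
    (∫ θ in (0 : ℝ)..Real.pi, Real.cos ((n + 2 : ℕ) * θ) / (t - 2 * Real.cos θ)) +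
      (∫ θ in (0 : ℝ)..Real.pi, Real.cos (n * θ) / (t - 2 * Real.cos θ)) =
      t * ∫ θ in (0 : ℝ)..Real.pi, Real.cos ((n + 1 : ℕ) * θ) / (t - 2 * Real.cos θ) := by
  have hi := fun m => (continuous_cos_nat_mul_div ht m).intervalIntegrable
    (μ := MeasureTheory.volume) 0 Real.pi
  refine Eq.trans ?_ ((congrArg (t * _ - ·)
    (integral_cos_nat_mul_zero_pi n.succ_ne_zero)).trans (sub_zero _))
  rw [← intervalIntegral.integral_add (hi _) (hi _), ← intervalIntegral.integral_const_mul,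
    ← intervalIntegral.integral_sub ((hi _).const_mul t)
      (Continuous.intervalIntegrable (by fun_prop) _ _)]
  refine intervalIntegral.integral_congr fun θ _ => ?_
  have hθ : t - 2 * Real.cos θ ≠ 0 := by linarith [Real.cos_le_one θ]
  have hadd : Real.cos ((n + 2 : ℕ) * θ) + Real.cos (n * θ) =
      2 * Real.cos θ * Real.cos ((n + 1 : ℕ) * θ) := by
    rw [show ((n + 2 : ℕ) : ℝ) * θ = (n + 1 : ℕ) * θ + θ by push_cast; ring,
      show (n : ℝ) * θ = (n + 1 : ℕ) * θ - θ by push_cast; ring, Real.cos_add, Real.cos_sub]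
    ring
  simp only [Nat.succ_eq_add_one]
  rw [← add_div, hadd]
  field_simp
  ring

theorem integral_cos_nat_mul_div {t : ℝ} (ht : 2 < t) (n : ℕ) :
    (∫ θ in (0 : ℝ)..Real.pi, Real.cos (n * θ) / (t - 2 * Real.cos θ)) =
      Real.pi * ((t - Real.sqrt (t ^ 2 - 4)) / 2) ^ n / Real.sqrt (t ^ 2 - 4) := by
  have hpos : 0 < t ^ 2 - 4 := by nlinarith
  have hs0 := Real.sqrt_pos.mpr hpos
  have hs2 := Real.sq_sqrt hpos.le
  set s := Real.sqrt (t ^ 2 - 4)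
  have hgeom := eq_pow_mul_of_bounded_of_recurrence
    (K := fun n : ℕ => ∫ θ in (0 : ℝ)..Real.pi, Real.cos (n * θ) / (t - 2 * Real.cos θ))
    (q := (t - s) / 2) (t := t) (by nlinarith) (by nlinarith) (by linear_combination -hs2 / 4)
    (abs_integral_cos_nat_mul_div_le ht) (integral_cos_nat_mul_div_recurrence ht)
  have h1 := hgeom 1
  have h01 := integral_cos_div_eq ht
  have hn := hgeom n
  beta_reduce at h1 hn
  rw [hn, eq_div_iff hs0.ne']
  linear_combination ((t - s) / 2) ^ n * (2 * h1 - h01)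

theorem integral_div_mul_sqrt_eq_integral_cos (f : ℝ → ℝ) (t : ℝ) :
    (∫ v in (-2 : ℝ)..2, f (v / 2) / ((t - v) * Real.sqrt (4 - v ^ 2))) =
      ∫ θ in (0 : ℝ)..Real.pi, f (Real.cos θ) / (t - 2 * Real.cos θ) := by
  rw [← Polynomial.Chebyshev.integral_measureT_eq_integral_cos
      (f := fun x => f x / (t - 2 * x)), Polynomial.Chebyshev.integral_measureT,
    show (-2 : ℝ) = 2 * -1 by norm_num]
  nth_rw 3 [show (2 : ℝ) = 2 * 1 by norm_num]
  rw [← intervalIntegral.mul_integral_comp_mul_left, ← intervalIntegral.integral_const_mul]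
  refine intervalIntegral.integral_congr fun x _ => ?_
  have hsqrt : Real.sqrt (4 - (2 * x) ^ 2) = 2 * Real.sqrt (1 - x ^ 2) := by
    rw [show 4 - (2 * x) ^ 2 = 2 ^ 2 * (1 - x ^ 2) by ring, Real.sqrt_mul (by norm_num),
      Real.sqrt_sq (by norm_num)]
  simp only [hsqrt, Real.sqrt_inv, mul_div_cancel_left₀ x (two_ne_zero' ℝ)]
  field_simp

/-- The real-place Gelfand–Graev–Piatetski-Shapiro identity: for `t > 2` and `T_n` the `n`-th
Chebyshev polynomial of the first kind,
`∫_{−2}^{2} T_n(v/2)/((t − v)√(4 − v²)) dv = π·((t − √(t² − 4))/2)^n / √(t² − 4)`. -/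
theorem stmt_17 (n : ℕ) (t : ℝ) (ht : 2 < t) :
    (∫ v in (-2 : ℝ)..2,
        (Polynomial.Chebyshev.T ℝ n).eval (v / 2) / ((t - v) * Real.sqrt (4 - v ^ 2))) =
      Real.pi * ((t - Real.sqrt (t ^ 2 - 4)) / 2) ^ n / Real.sqrt (t ^ 2 - 4) := by
  rw [integral_div_mul_sqrt_eq_integral_cos (fun x => (Polynomial.Chebyshev.T ℝ n).eval x),
    ← integral_cos_nat_mul_div ht n]
  simp [Polynomial.Chebyshev.T_real_cos]
end
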